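/- arXiv:2401.10154 — 5 statements merged into one kernel-verified Lean document; each statement's English description precedes it below -/
import Mathlib

section
/- There is a Diophantine set that is not computable: there exist n ∈ ℕ and a polynomial p ∈ MvPolynomial (Fin (n+1)) ℤ such that the set {a : ℕ | ∃ x : Fin n → ℕ, p(a, x) = 0} is not a computable (decidable) predicate. Consequently there is no algorithm which, given the parameter a, decides whether the Diophantine equation p(a, x) = 0 has a solution in natural numbers. -/
namespace H10
open Nat

theorem digit_sum (U : ℕ) (hU : 0 < U) : ∀ (k n : ℕ) (c : ℕ → ℕ), (∀ i, c i < U) →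
    (∑ i ∈ Finset.range n, c i * U ^ i) / U ^ k % U = if k < n then c k else 0
  | k, 0, c, h => by simp
  | 0, n+1, c, h => by
    rw [Finset.sum_range_succ']
    have : ∑ i ∈ Finset.range n, c (i+1) * U ^ (i+1) = U * ∑ i ∈ Finset.range n, c (i+1) * U ^ i := by
      rw [Finset.mul_sum]; refine Finset.sum_congr rfl fun i _ => by ring
    rw [this]
    simp [Nat.mod_eq_of_lt (h 0)]
  | k+1, n+1, c, h => by
    rw [Finset.sum_range_succ']
    have : ∑ i ∈ Finset.range n, c (i+1) * U ^ (i+1) = U * ∑ i ∈ Finset.range n, c (i+1) * U ^ i := by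
      rw [Finset.mul_sum]; refine Finset.sum_congr rfl fun i _ => by ring
    rw [this, pow_succ', ← Nat.div_div_eq_div_mul, pow_zero, mul_one, Nat.mul_add_div hU,
      Nat.div_eq_of_lt (h 0), add_zero, digit_sum U hU k n (fun i => c (i+1)) (fun i => h _)]
    simp

theorem choose_eq (n k : ℕ) :
    n.choose k = (2 ^ n + 1 + 1) ^ n / (2 ^ n + 1) ^ k % (2 ^ n + 1) := by
  have h := digit_sum (2 ^ n + 1) (by positivity) k (n+1) (fun i => n.choose i)
    (fun i => Nat.lt_succ_of_le (Nat.choose_le_two_pow n i))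
  have e : (2 ^ n + 1 + 1) ^ n = ∑ i ∈ Finset.range (n+1), n.choose i * (2 ^ n + 1) ^ i := by
    rw [add_pow]; refine Finset.sum_congr rfl fun i _ => by simp [mul_comm]
  rw [e, h]
  split_ifs with hk
  · rfl
  · exact Nat.choose_eq_zero_of_lt (by omega)

theorem desc_bound (r n : ℕ) (hr : n ≤ r) : ∀ k, k ≤ n →
    r ^ (k+1) ≤ r * r.descFactorial k + k * n * r ^ k
  | 0, _ => by simp
  | k+1, h => by
    have ih := desc_bound r n hr k (by omega)
    rw [Nat.descFactorial_succ]
    obtain ⟨s, rfl⟩ : ∃ s, r = s + k := ⟨r - k, by omega⟩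
    have h2 : (s+k).descFactorial k ≤ (s+k)^k := Nat.descFactorial_le_pow _ _
    rw [Nat.add_sub_cancel]
    have h3 : (s+k) * (s+k)^(k+1) ≤ (s+k) * ((s+k) * (s+k).descFactorial k + k * n * (s+k) ^ k) :=
      Nat.mul_le_mul_left _ ih
    have h4 : k * ((s+k) * (s+k).descFactorial k) ≤ n * ((s+k) * (s+k)^k) :=
      Nat.mul_le_mul (by omega) (Nat.mul_le_mul_left _ h2)
    calc (s+k)^(k+1+1) = (s+k) * (s+k)^(k+1) := by ring
      _ ≤ _ := h3
      _ = (s+k) * (s * (s+k).descFactorial k) + k * ((s+k) * (s+k).descFactorial k)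
          + k * n * (s+k)^(k+1) := by ring
      _ ≤ (s+k) * (s * (s+k).descFactorial k) + n * ((s+k) * (s+k)^k)
          + k * n * (s+k)^(k+1) := by omega
      _ = _ := by ring

theorem factorial_eq (n r : ℕ) (hr : r = (n ^ n + 1) * (n * n) + n + 1) :
    n ! = r ^ n / r.choose n := by
  have hrn : n ≤ r := by rw [hr]; omega
  have hc : 0 < r.choose n := Nat.choose_pos hrn
  have hd := Nat.descFactorial_eq_factorial_mul_choose r n
  symm
  rw [Nat.div_eq_iff hc]
  have h1 := Nat.descFactorial_le_pow r n
  have h2 := desc_bound r n hrn n le_rfl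
  have h3 : n ! ≤ n ^ n := Nat.factorial_le_pow n
  have h4 : (n ! + 1) * (n * n) < r := by
    have : (n ! + 1) * (n * n) ≤ (n ^ n + 1) * (n * n) := Nat.mul_le_mul_right _ (by omega)
    omega
  have hr0 : 0 < r := by omega
  have hf : 0 < n ! := Nat.factorial_pos n
  have key : r ^ n < (n ! + 1) * r.choose n := by
    by_contra hcon
    push Not at hcon
    have h5 : (n ! + 1) * (r * r.descFactorial n) ≤ n ! * r ^ (n+1) := by
      rw [hd]
      calc (n ! + 1) * (r * (n ! * r.choose n)) = (n ! * r) * ((n ! + 1) * r.choose n) := by ring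
        _ ≤ (n ! * r) * r ^ n := Nat.mul_le_mul_left _ hcon
        _ = _ := by ring
    have h6 := Nat.mul_le_mul_left (n ! + 1) h2
    have h7 : (n ! + 1) * (n * n) * r ^ n < r * r ^ n :=
      Nat.mul_lt_mul_of_pos_right h4 (by positivity)
    have e : r ^ (n+1) = r * r ^ n := by ring
    rw [mul_add, ← mul_assoc (n ! + 1) (n * n)] at h6
    rw [← e] at h7
    have h8 : (n ! + 1) * r ^ (n+1) = n ! * r ^ (n+1) + r ^ (n+1) := by ring
    omega
  constructor
  · omega
  · have : (n ! + 1) * r.choose n = n ! * r.choose n + r.choose n := by ring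
    omega

/-- Arithmetic core. -/
theorem core (Q y : ℕ) (hy : y ≤ Q) (hQ : 3 ≤ Q) :
    ∃ m : ℕ → ℕ, ((Q.factorial * Q.factorial - 1).choose y = ∏ k ∈ Finset.range y, m k) ∧
      (∀ k < y, m k ≠ 0 ∧ m k ≠ 1 ∧ (Q.factorial * Q.factorial - 1) ≡ k [MOD m k] ∧
        (∀ p, p.Prime → p ∣ m k → Q < p)) ∧
      Set.Pairwise (Finset.range y : Set ℕ) (Function.onFun Nat.Coprime m) := by
  have hf : 6 ≤ Q.factorial := by
    have := Nat.factorial_le hQ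
    simpa [Nat.factorial] using this
  have hbig : Q ≤ Q.factorial := Nat.self_le_factorial Q
  have hbig2 : 6 * Q.factorial ≤ Q.factorial * Q.factorial := Nat.mul_le_mul_right _ hf
  set N := Q.factorial * Q.factorial - 1 with hN
  have hdvd : ∀ k < y, ∃ d, Q.factorial = (k+1) * d ∧ 0 < d := by
    intro k hk
    obtain ⟨d, hd⟩ := Nat.dvd_factorial (Nat.succ_pos k) (show k+1 ≤ Q by omega)
    refine ⟨d, hd, Nat.pos_of_ne_zero ?_⟩
    rintro rfl
    simp at hd; omega
  choose! d hd hd0 using hdvd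
  have hmk : ∀ k < y, (d k * Q.factorial - 1) * (k+1) = N - k := by
    intro k hk
    have := hd k hk
    have e : Q.factorial * Q.factorial = d k * Q.factorial * (k+1) := by
      conv_lhs => rw [show Q.factorial * Q.factorial = (k+1) * d k * Q.factorial by rw [← this]]
      ring
    rw [Nat.sub_mul, ← e, hN]; omega
  have hmod : ∀ k < y, N ≡ k [MOD d k * Q.factorial - 1] := by
    intro k hk
    refine ((Nat.modEq_iff_dvd' (by omega)).2 ⟨k+1, (hmk k hk).symm⟩).symm
  have hp : ∀ k < y, ∀ p, p.Prime → p ∣ d k * Q.factorial - 1 → Q < p := by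
    intro k hk p pp hpd
    by_contra hcon
    have h1 : p ∣ Q.factorial := Nat.dvd_factorial pp.pos (by omega)
    have h2 : p ∣ d k * Q.factorial := h1.mul_left _
    have h3 : 1 ≤ d k * Q.factorial := Nat.mul_pos (hd0 k hk) (by omega)
    have := (Nat.dvd_sub_iff_right h3 h2).1 hpd
    exact pp.one_lt.ne' (Nat.dvd_one.1 this)
  refine ⟨fun k => d k * Q.factorial - 1, ?_, ?_, ?_⟩
  · have : ∀ j ≤ y, N.choose j = ∏ k ∈ Finset.range j, (d k * Q.factorial - 1) := by
      intro j
      induction j with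
      | zero => simp
      | succ j ih =>
        intro hj
        rw [Finset.prod_range_succ, ← ih (by omega)]
        have h := Nat.choose_succ_right_eq N j
        rw [← hmk j (by omega), ← mul_assoc] at h
        exact Nat.eq_of_mul_eq_mul_right (Nat.succ_pos j) h
    exact this y le_rfl
  · intro k hk
    have h3 : 1 * 6 ≤ d k * Q.factorial := Nat.mul_le_mul (hd0 k hk) hf
    exact ⟨by dsimp only; omega, by dsimp only; omega, hmod k hk, hp k hk⟩
  · intro k hk l hl hkl
    simp only [Finset.coe_range, Set.mem_Iio] at hk hl
    refine Nat.coprime_of_dvd ?_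
    intro p pp h1 h2
    have hQp := hp k hk p pp h1
    have e1 := (hmod k hk).of_dvd h1
    have e2 := (hmod l hl).of_dvd h2
    have := e1.symm.trans e2
    rw [Nat.ModEq, Nat.mod_eq_of_lt (by omega), Nat.mod_eq_of_lt (by omega)] at this
    exact hkl this

theorem mod_le_of_dvd_desc (p a u : ℕ) (pp : p.Prime) (h : p ∣ a.descFactorial (u+1)) : a % p ≤ u := by
  by_cases ha : a ≤ u
  · exact (Nat.mod_le _ _).trans ha
  · rw [Nat.descFactorial_eq_prod_range, pp.prime.dvd_finsetProd_iff] at h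
    obtain ⟨j, hj, hd⟩ := h
    rw [Finset.mem_range] at hj
    have : j ≡ a [MOD p] := (Nat.modEq_iff_dvd' (by omega)).2 hd
    rw [← this]
    exact (Nat.mod_le _ _).trans (by omega)

theorem dvd_desc (m a u t : ℕ) (ht : t ≤ u) (h : a ≡ t [MOD m]) : m ∣ a.descFactorial (u+1) := by
  by_cases ha : a ≤ u
  · rw [Nat.descFactorial_eq_zero_iff_lt.2 (by omega)]; exact dvd_zero _
  · rw [Nat.descFactorial_eq_prod_range]
    exact ((Nat.modEq_iff_dvd' (by omega)).1 h.symm).trans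
      (Finset.dvd_prod_of_mem _ (Finset.mem_range.2 (by omega)))


/-! ### Diophantine part -/

open Dioph Fin2 Sum

theorem choose_dioph {α : Type} {f g : (α → ℕ) → ℕ} (df : DiophFn f) (dg : DiophFn g) :
    DiophFn fun v => (f v).choose (g v) := by
  have h1 : DiophFn fun v => 2 ^ f v + 1 := add_dioph (pow_dioph (const_dioph 2) df) (const_dioph 1)
  have := mod_dioph (div_dioph (pow_dioph (add_dioph h1 (const_dioph 1)) df) (pow_dioph h1 dg)) h1
  have e : (fun v => (f v).choose (g v)) = _ := funext fun v => choose_eq (f v) (g v)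
  rw [e]; exact this

theorem factorial_dioph {α : Type} {f : (α → ℕ) → ℕ} (df : DiophFn f) :
    DiophFn fun v => (f v).factorial := by
  have h1 : DiophFn fun v => (f v ^ f v + 1) * (f v * f v) + f v + 1 :=
    add_dioph (add_dioph (mul_dioph (add_dioph (pow_dioph df df) (const_dioph 1))
      (mul_dioph df df)) df) (const_dioph 1)
  have := div_dioph (pow_dioph h1 df) (choose_dioph h1 df)
  have e : (fun v => (f v).factorial) = _ := funext fun v => factorial_eq (f v) _ rfl
  rw [e]; exact this

theorem desc_dioph {α : Type} {f g : (α → ℕ) → ℕ} (df : DiophFn f) (dg : DiophFn g) :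
    DiophFn fun v => (f v).descFactorial (g v) := by
  have := mul_dioph (factorial_dioph dg) (choose_dioph df dg)
  have e : (fun v => (f v).descFactorial (g v)) = _ :=
    funext fun v => Nat.descFactorial_eq_factorial_mul_choose (f v) (g v)
  rw [e]; exact this

/-- Substitution of Diophantine functions into a polynomial. -/
theorem poly_comp {α γ : Type} (p : Poly γ) (g : γ → (α → ℕ) → ℕ) (dg : ∀ c, DiophFn (g c)) :
    ∃ a b : (α → ℕ) → ℕ, DiophFn a ∧ DiophFn b ∧
      ∀ v, p (fun c => g c v) = (a v : ℤ) - (b v : ℤ) := by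
  induction p using Poly.induction with
  | H1 i => exact ⟨g i, fun _ => 0, dg i, const_dioph 0, fun v => by simp⟩
  | H2 n => exact ⟨fun _ => n.toNat, fun _ => (-n).toNat, const_dioph _, const_dioph _,
      fun v => by simp⟩
  | H3 p q hp hq =>
    obtain ⟨a, b, da, db, h⟩ := hp
    obtain ⟨a', b', da', db', h'⟩ := hq
    refine ⟨fun v => a v + b' v, fun v => b v + a' v, add_dioph da db', add_dioph db da', fun v => ?_⟩
    rw [Poly.sub_apply, h, h']; push_cast; ring
  | H4 p q hp hq =>
    obtain ⟨a, b, da, db, h⟩ := hp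
    obtain ⟨a', b', da', db', h'⟩ := hq
    refine ⟨fun v => a v * a' v + b v * b' v, fun v => a v * b' v + b v * a' v,
      add_dioph (mul_dioph da da') (mul_dioph db db'),
      add_dioph (mul_dioph da db') (mul_dioph db da'), fun v => ?_⟩
    rw [Poly.mul_apply, h, h']; push_cast; ring

theorem natAbs_poly_comp {α γ : Type} (p : Poly γ) (g : γ → (α → ℕ) → ℕ) (dg : ∀ c, DiophFn (g c)) :
    DiophFn fun v => (p (fun c => g c v)).natAbs := by
  obtain ⟨a, b, da, db, h⟩ := poly_comp p g dg
  have := add_dioph (sub_dioph da db) (sub_dioph db da)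
  have e : (fun v => (p (fun c => g c v)).natAbs) = fun v => (a v - b v) + (b v - a v) :=
    funext fun v => by rw [h]; omega
  rw [e]; exact this

theorem poly_bound {γ : Type} (p : Poly γ) :
    ∃ q : Poly γ, ∀ x x' : γ → ℕ, (∀ c, x c ≤ x' c) → |p x| ≤ q x' := by
  induction p using Poly.induction with
  | H1 i => exact ⟨Poly.proj i, fun x x' h => by simpa using h i⟩
  | H2 n => exact ⟨Poly.const |n|, fun x x' h => by simp⟩
  | H3 p q hp hq =>
    obtain ⟨p', hp⟩ := hp
    obtain ⟨q', hq⟩ := hq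
    refine ⟨p' + q', fun x x' h => ?_⟩
    rw [Poly.sub_apply, Poly.add_apply]
    exact (abs_sub _ _).trans (add_le_add (hp x x' h) (hq x x' h))
  | H4 p q hp hq =>
    obtain ⟨p', hp⟩ := hp
    obtain ⟨q', hq⟩ := hq
    refine ⟨p' * q', fun x x' h => ?_⟩
    rw [Poly.mul_apply, Poly.mul_apply, abs_mul]
    exact mul_le_mul (hp x x' h) (hq x x' h) (abs_nonneg _) ((abs_nonneg _).trans (hp x x' h))

theorem poly_modEq {γ : Type} (p : Poly γ) (m : ℕ) (x x' : γ → ℕ) (h : ∀ c, x c ≡ x' c [MOD m]) :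
    p x ≡ p x' [ZMOD m] := by
  induction p using Poly.induction with
  | H1 i => exact (Int.natCast_modEq_iff.2 (h i))
  | H2 n => exact Int.ModEq.refl _
  | H3 p q hp hq => exact hp.sub hq
  | H4 p q hp hq => exact hp.mul hq

theorem poly_support {γ : Type} (p : Poly γ) :
    ∃ F : Finset γ, ∀ x x' : γ → ℕ, (∀ c ∈ F, x c = x' c) → p x = p x' := by
  classical
  induction p using Poly.induction with
  | H1 i => exact ⟨{i}, fun x x' h => by simpa using h⟩
  | H2 n => exact ⟨∅, fun x x' h => rfl⟩
  | H3 p q hp hq =>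
    obtain ⟨F, hF⟩ := hp
    obtain ⟨G, hG⟩ := hq
    refine ⟨F ∪ G, fun x x' h => ?_⟩
    rw [Poly.sub_apply, Poly.sub_apply, hF x x' fun c hc => h c (Finset.mem_union_left _ hc),
      hG x x' fun c hc => h c (Finset.mem_union_right _ hc)]
  | H4 p q hp hq =>
    obtain ⟨F, hF⟩ := hp
    obtain ⟨G, hG⟩ := hq
    refine ⟨F ∪ G, fun x x' h => ?_⟩
    rw [Poly.mul_apply, Poly.mul_apply, hF x x' fun c hc => h c (Finset.mem_union_left _ hc),
      hG x x' fun c hc => h c (Finset.mem_union_right _ hc)]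

theorem fin_dummies {α : Type} {S : Set (α → ℕ)} (d : Dioph S) :
    ∃ (n : ℕ) (p : Poly (α ⊕ Fin n)), ∀ v, v ∈ S ↔ ∃ t, p (Sum.elim v t) = 0 := by
  classical
  obtain ⟨β, p, hp⟩ := d
  obtain ⟨F, hF⟩ := poly_support p
  let G : Finset β := F.preimage Sum.inr (Sum.inr_injective.injOn)
  let e : Option G ≃ Fin (Fintype.card (Option G)) := Fintype.equivFin _
  let g : β → Option G := fun b => if h : b ∈ G then some ⟨b, h⟩ else none
  refine ⟨_, p.map (Sum.elim Sum.inl (fun b => Sum.inr (e (g b)))), fun v => (hp v).trans ⟨?_, ?_⟩⟩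
  · rintro ⟨t, ht⟩
    refine ⟨fun i => (e.symm i).elim 0 (fun b => t b.1), ?_⟩
    rw [Poly.map_apply, ← ht]
    refine hF _ _ fun c hc => ?_
    rcases c with a | b
    · rfl
    · have hb : b ∈ G := by simpa [G] using hc
      simp [g, hb]
  · rintro ⟨t, ht⟩
    refine ⟨fun b => t (e (g b)), ?_⟩
    rw [Poly.map_apply] at ht
    rw [← ht]
    congr 1
    funext c
    rcases c with a | b <;> rfl

theorem forall_fin_dioph {α : Type} : ∀ (n : ℕ) (S : Fin n → Set (α → ℕ)), (∀ i, Dioph (S i)) →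
    Dioph {v | ∀ i, v ∈ S i}
  | 0, S, h => Dioph.ext (eq_dioph (const_dioph 0) (const_dioph 0)) (by simp)
  | n+1, S, h => Dioph.ext (Dioph.inter (h 0) (forall_fin_dioph n (fun i => S i.succ) fun i => h _))
      (fun v => by
        simp only [Set.mem_inter_iff, Set.mem_ofPred_eq]
        exact (Fin.forall_fin_succ (P := fun i => v ∈ S i)).symm)

/-- The bounded quantifier theorem, arithmetical form. -/
theorem ball_iff {α : Type} {n : ℕ} (p q : Poly (Option α ⊕ Fin n))
    (hq : ∀ x x' : Option α ⊕ Fin n → ℕ, (∀ c, x c ≤ x' c) → |p x| ≤ q x')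
    (v : α → ℕ) (y : ℕ) (Q : ℕ → ℕ)
    (hQ : ∀ u, Q u = (q (Sum.elim (Option.elim' y v) (fun _ => u))).natAbs + u + y + 3) :
    (∀ k < y, ∃ t, p (Sum.elim (Option.elim' k v) t) = 0) ↔
    ∃ x : Option (Fin n) → ℕ,
      (∀ i, ((Q (x none)).factorial * (Q (x none)).factorial - 1).choose y ∣
        (x (some i)).descFactorial (x none + 1)) ∧
      ((Q (x none)).factorial * (Q (x none)).factorial - 1).choose y ∣
        (p (Sum.elim (Option.elim' ((Q (x none)).factorial * (Q (x none)).factorial - 1) v)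
          (fun i => x (some i)))).natAbs := by
  constructor
  · intro h
    choose! t ht using h
    let u : ℕ := (Finset.range y).sup fun k => Finset.univ.sup (t k)
    have hu : ∀ k < y, ∀ i, t k i ≤ u := fun k hk i =>
      (Finset.le_sup (f := t k) (Finset.mem_univ i)).trans
        (Finset.le_sup (f := fun k => Finset.univ.sup (t k)) (Finset.mem_range.2 hk))
    obtain ⟨m, hm, hmk, hco⟩ := core (Q u) y (by rw [hQ]; omega) (by rw [hQ]; omega)
    have hcrt : ∀ i, ∃ a, ∀ k ∈ Finset.range y, a ≡ t k i [MOD m k] := fun i =>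
      ⟨_, (Nat.chineseRemainderOfFinset (fun k => t k i) m (Finset.range y)
        (fun k hk => (hmk k (Finset.mem_range.1 hk)).1) hco).2⟩
    choose a ha using hcrt
    refine ⟨Option.elim' u a, ?_, ?_⟩
    · intro i
      simp only [Option.elim'_none, Option.elim'_some]
      rw [hm]
      refine Finset.prod_dvd_of_isRelPrime (fun k hk l hl hkl => Nat.coprime_iff_isRelPrime.1 (hco hk hl hkl)) ?_
      intro k hk
      exact dvd_desc _ _ _ _ (hu k (Finset.mem_range.1 hk) i) (ha i k hk)
    · simp only [Option.elim'_none, Option.elim'_some]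
      rw [hm]
      refine Finset.prod_dvd_of_isRelPrime (fun k hk l hl hkl => Nat.coprime_iff_isRelPrime.1 (hco hk hl hkl)) ?_
      intro k hk
      have hk' := Finset.mem_range.1 hk
      rw [← Int.natCast_dvd, ← Int.modEq_zero_iff_dvd, ← ht k hk']
      refine poly_modEq _ _ _ _ fun c => ?_
      rcases c with (_ | c) | i
      · exact (hmk k hk').2.2.1
      · exact Nat.ModEq.refl _
      · exact ha i k hk
  · rintro ⟨x, h1, h2⟩ k hk
    set u := x none with hu
    obtain ⟨m, hm, hmk, hco⟩ := core (Q u) y (by rw [hQ]; omega) (by rw [hQ]; omega)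
    obtain ⟨-, hm1, hmod, hpr⟩ := hmk k hk
    obtain ⟨r, rp, hr⟩ := Nat.exists_prime_and_dvd hm1
    have hrQ := hpr r rp hr
    have hrM : r ∣ ((Q u).factorial * (Q u).factorial - 1).choose y := by
      rw [hm]; exact hr.trans (Finset.dvd_prod_of_mem _ (Finset.mem_range.2 hk))
    refine ⟨fun i => x (some i) % r, ?_⟩
    have hle : |p (Sum.elim (Option.elim' k v) fun i => x (some i) % r)| ≤
        q (Sum.elim (Option.elim' y v) (fun _ => u)) := by
      refine hq _ _ fun c => ?_
      rcases c with (_ | c) | i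
      · exact hk.le
      · exact le_rfl
      · exact mod_le_of_dvd_desc r _ u rp (hrM.trans (h1 i))
    have hdv : (r : ℤ) ∣ p (Sum.elim (Option.elim' k v) fun i => x (some i) % r) := by
      rw [← Int.modEq_zero_iff_dvd]
      refine Int.ModEq.trans ?_ (Int.modEq_zero_iff_dvd.2 (Int.natCast_dvd.2 (hrM.trans h2)))
      refine poly_modEq _ _ _ _ fun c => ?_
      rcases c with (_ | c) | i
      · exact (hmod.of_dvd hr).symm
      · exact Nat.ModEq.refl _
      · exact Nat.mod_modEq _ _
    refine Int.eq_zero_of_abs_lt_dvd hdv ?_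
    have := hQ u
    omega

theorem ball_dioph {α : Type} {S : Set (Option α → ℕ)} (d : Dioph S) {f : (α → ℕ) → ℕ}
    (df : DiophFn f) : Dioph {v : α → ℕ | ∀ k < f v, Option.elim' k v ∈ S} := by
  obtain ⟨n, p, hp⟩ := fin_dummies d
  obtain ⟨q, hq⟩ := poly_bound p
  let Y : (α ⊕ Option (Fin n) → ℕ) → ℕ := fun w => f (w ∘ Sum.inl)
  have dY : DiophFn Y := reindex_diophFn Sum.inl df
  let Q : (α ⊕ Option (Fin n) → ℕ) → ℕ := fun w =>
    (q (fun c => (Sum.elim (Option.elim' (Y w) (fun a => w (Sum.inl a)))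
      (fun _ => w (Sum.inr none)) : Option α ⊕ Fin n → ℕ) c)).natAbs + w (Sum.inr none) + Y w + 3
  have dQ : DiophFn Q := by
    refine add_dioph (add_dioph (add_dioph ?_ (proj_dioph _)) dY) (const_dioph 3)
    refine natAbs_poly_comp q (fun c w => (Sum.elim (Option.elim' (Y w) (fun a => w (Sum.inl a)))
      (fun _ => w (Sum.inr none)) : Option α ⊕ Fin n → ℕ) c) ?_
    rintro ((_ | c) | i)
    · exact dY
    · exact proj_dioph (Sum.inl c)
    · exact proj_dioph (Sum.inr none)
  let N : (α ⊕ Option (Fin n) → ℕ) → ℕ := fun w => (Q w).factorial * (Q w).factorial - 1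
  have dN : DiophFn N :=
    sub_dioph (mul_dioph (factorial_dioph dQ) (factorial_dioph dQ)) (const_dioph 1)
  have dM : DiophFn fun w => (N w).choose (Y w) := choose_dioph dN dY
  have d1 : Dioph {w | ∀ i : Fin n, w ∈ {w : α ⊕ Option (Fin n) → ℕ |
      (N w).choose (Y w) ∣ (w (Sum.inr (some i))).descFactorial (w (Sum.inr none) + 1)}} :=
    forall_fin_dioph n _ fun i =>
      dvd_dioph dM (desc_dioph (proj_dioph _) (add_dioph (proj_dioph _) (const_dioph 1)))
  have d2 : Dioph {w : α ⊕ Option (Fin n) → ℕ | (N w).choose (Y w) ∣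
      (p (fun c => (Sum.elim (Option.elim' (N w) (fun a => w (Sum.inl a)))
        (fun i => w (Sum.inr (some i))) : Option α ⊕ Fin n → ℕ) c)).natAbs} := by
    refine dvd_dioph dM ?_
    refine natAbs_poly_comp p (fun c w => (Sum.elim (Option.elim' (N w) (fun a => w (Sum.inl a)))
      (fun i => w (Sum.inr (some i))) : Option α ⊕ Fin n → ℕ) c) ?_
    rintro ((_ | c) | i)
    · exact dN
    · exact proj_dioph (Sum.inl c)
    · exact proj_dioph (Sum.inr (some i))
  refine Dioph.ext (ex_dioph (d1.inter d2)) fun v => ?_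
  have key := ball_iff p q hq v (f v)
    (fun u => (q (Sum.elim (Option.elim' (f v) v) (fun _ => u))).natAbs + u + f v + 3)
    (fun u => rfl)
  simp only [Set.mem_ofPred_eq, hp]
  rw [key]
  rfl


/-! ### Partial recursive functions have Diophantine graphs -/

theorem ex_dioph' {α : Type} {S : ℕ → (α → ℕ) → Prop}
    (h : Dioph {w : Option α → ℕ | S (w none) (w ∘ some)}) : Dioph {v | ∃ x, S x v} :=
  ex1_dioph h

theorem ball_dioph' {α : Type} {S : ℕ → (α → ℕ) → Prop} {f : (α → ℕ) → ℕ} (df : DiophFn f)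
    (h : Dioph {w : Option α → ℕ | S (w none) (w ∘ some)}) : Dioph {v | ∀ k < f v, S k v} :=
  ball_dioph h df

theorem lift_dioph {α : Type} {f : (α → ℕ) → ℕ} (df : DiophFn f) :
    DiophFn fun w : Option α → ℕ => f (w ∘ some) := reindex_diophFn some df

theorem pair_dioph {α : Type} {f g : (α → ℕ) → ℕ} (df : DiophFn f) (dg : DiophFn g) :
    DiophFn fun v => Nat.pair (f v) (g v) := by
  have df' := lift_dioph df
  have dg' := lift_dioph dg
  have dz : DiophFn fun w : Option α → ℕ => w none := proj_dioph none
  refine Dioph.ext (Dioph.union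
    ((lt_dioph df' dg').inter (eq_dioph (add_dioph (mul_dioph dg' dg') df') dz))
    ((le_dioph dg' df').inter (eq_dioph (add_dioph (add_dioph (mul_dioph df' df') df') dg') dz)))
    fun v => ?_
  simp only [Set.mem_union, Set.mem_inter_iff, Set.mem_ofPred_eq, Nat.pair]
  split_ifs with h <;> simp [h]
  omega

theorem unpair1_dioph {α : Type} {f : (α → ℕ) → ℕ} (df : DiophFn f) :
    DiophFn fun v => (f v).unpair.1 := by
  refine Dioph.ext (ex_dioph' (S := fun y w => Nat.pair (w none) y = f (w ∘ some))
    (eq_dioph (pair_dioph (proj_dioph (some none)) (proj_dioph none)) (lift_dioph (lift_dioph df))))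
    fun v => ?_
  simp only [Set.mem_ofPred_eq]
  constructor
  · rintro ⟨y, h⟩; rw [← h]; simp
  · intro h; exact ⟨(f (v ∘ some)).unpair.2, by rw [← h]; simp⟩

theorem unpair2_dioph {α : Type} {f : (α → ℕ) → ℕ} (df : DiophFn f) :
    DiophFn fun v => (f v).unpair.2 := by
  refine Dioph.ext (ex_dioph' (S := fun y w => Nat.pair y (w none) = f (w ∘ some))
    (eq_dioph (pair_dioph (proj_dioph none) (proj_dioph (some none))) (lift_dioph (lift_dioph df))))
    fun v => ?_
  simp only [Set.mem_ofPred_eq]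
  constructor
  · rintro ⟨y, h⟩; rw [← h]; simp
  · intro h; exact ⟨(f (v ∘ some)).unpair.1, by rw [← h]; simp⟩

theorem beta_dioph {α : Type} {f g : (α → ℕ) → ℕ} (df : DiophFn f) (dg : DiophFn g) :
    DiophFn fun v => Nat.beta (f v) (g v) :=
  mod_dioph (unpair1_dioph df)
    (add_dioph (mul_dioph (add_dioph dg (const_dioph 1)) (unpair2_dioph df)) (const_dioph 1))

theorem rec_iff (f : Part ℕ) (g : ℕ → ℕ → Part ℕ) (z : ℕ) (k : ℕ) :
    z ∈ (Nat.rec f (fun y IH => IH >>= fun i => g y i) k : Part ℕ) ↔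
    ∃ s : ℕ → ℕ, s 0 ∈ f ∧ (∀ i < k, s (i+1) ∈ g i (s i)) ∧ s k = z := by
  induction k generalizing z with
  | zero =>
    constructor
    · intro h; exact ⟨fun _ => z, h, by simp, rfl⟩
    · rintro ⟨s, h, -, rfl⟩; exact h
  | succ k ih =>
    simp only [Part.bind_eq_bind, Part.mem_bind_iff]
    constructor
    · rintro ⟨y, hy, hz⟩
      obtain ⟨s, h0, h1, h2⟩ := (ih y).1 hy
      refine ⟨fun i => if i = k + 1 then z else s i, by simpa using h0, ?_, by simp⟩
      intro i hi
      rcases Nat.lt_succ_iff_lt_or_eq.1 hi with h | rfl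
      · have e1 : i ≠ k := by omega
        have e2 : i ≠ k + 1 := by omega
        simpa [e1, e2] using h1 i h
      · simpa [h2] using hz
    · rintro ⟨s, h0, h1, rfl⟩
      exact ⟨s k, (ih _).2 ⟨s, h0, fun i hi => h1 i (by omega), rfl⟩, h1 k (by omega)⟩

theorem rec_iff_beta (f : Part ℕ) (g : ℕ → ℕ → Part ℕ) (z : ℕ) (k : ℕ) :
    z ∈ (Nat.rec f (fun y IH => IH >>= fun i => g y i) k : Part ℕ) ↔
    ∃ c : ℕ, Nat.beta c 0 ∈ f ∧ (∀ i < k, Nat.beta c (i+1) ∈ g i (Nat.beta c i)) ∧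
      Nat.beta c k = z := by
  rw [rec_iff]
  constructor
  · rintro ⟨s, h0, h1, h2⟩
    have hb : ∀ i ≤ k, Nat.beta (Nat.unbeta ((List.range (k+1)).map s)) i = s i := by
      intro i hi
      have := Nat.beta_unbeta_coe ((List.range (k+1)).map s) ⟨i, by simp; omega⟩
      simpa using this
    refine ⟨_, by rw [hb 0 (by omega)]; exact h0, fun i hi => ?_, by rw [hb k le_rfl]; exact h2⟩
    rw [hb _ (by omega), hb _ (by omega)]; exact h1 i hi
  · rintro ⟨c, h⟩; exact ⟨Nat.beta c, h⟩

theorem partrec_dioph {f : ℕ →. ℕ} (hf : Nat.Partrec f) :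
    ∀ {α : Type} (g h : (α → ℕ) → ℕ), DiophFn g → DiophFn h → Dioph {v | h v ∈ f (g v)} := by
  induction hf with
  | zero =>
    intro α g h dg dh
    exact Dioph.ext (eq_dioph dh (const_dioph 0)) fun v => by
      simp [Pure.pure, PFun.pure]
  | succ =>
    intro α g h dg dh
    exact Dioph.ext (eq_dioph dh (add_dioph dg (const_dioph 1))) fun v => by
      simp
  | left =>
    intro α g h dg dh
    exact Dioph.ext (eq_dioph dh (unpair1_dioph dg)) fun v => by
      simp
  | right =>
    intro α g h dg dh
    exact Dioph.ext (eq_dioph dh (unpair2_dioph dg)) fun v => by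
      simp
  | pair _ _ ih1 ih2 =>
    rename_i f1 f2 _ _
    intro α g h dg dh
    refine Dioph.ext ((ih1 g (fun v => (h v).unpair.1) dg (unpair1_dioph dh)).inter
      (ih2 g (fun v => (h v).unpair.2) dg (unpair2_dioph dh))) fun v => ?_
    simp only [Set.mem_inter_iff, Set.mem_ofPred_eq, Seq.seq, Part.map_eq_map, Part.mem_bind_iff, Part.mem_map_iff]
    constructor
    · rintro ⟨h1, h2⟩
      exact ⟨_, ⟨_, h1, rfl⟩, _, h2, by simp⟩
    · rintro ⟨_, ⟨a, h1, rfl⟩, b, h2, h3⟩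
      rw [← h3]; simpa using ⟨h1, h2⟩
  | comp _ _ ih1 ih2 =>
    rename_i f1 f2 _ _
    intro α g h dg dh
    refine Dioph.ext (ex_dioph' (S := fun y v => y ∈ f2 (g v) ∧ h v ∈ f1 y)
      ((ih2 _ _ (lift_dioph dg) (proj_dioph none)).inter
        (ih1 _ _ (proj_dioph none) (lift_dioph dh)))) fun v => ?_
    exact Part.mem_bind_iff.symm
  | prec _ _ ih1 ih2 =>
    rename_i f1 f2 _ _
    intro α g h dg dh
    have dg2 := lift_dioph dg
    have dg3 := lift_dioph dg2
    have dc2 : DiophFn fun w : Option α → ℕ => w none := proj_dioph none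
    have dc3 := lift_dioph dc2
    have di3 : DiophFn fun w : Option (Option α) → ℕ => w none := proj_dioph none
    refine Dioph.ext (ex_dioph' (S := fun c v => Nat.beta c 0 ∈ f1 (g v).unpair.1 ∧
      (∀ i < (g v).unpair.2, Nat.beta c (i+1) ∈
        f2 (Nat.pair (g v).unpair.1 (Nat.pair i (Nat.beta c i)))) ∧
      Nat.beta c (g v).unpair.2 = h v) ?_) fun v => ?_
    · refine Dioph.inter (ih1 _ _ (unpair1_dioph dg2) (beta_dioph dc2 (const_dioph 0)))
        (Dioph.inter ?_ (eq_dioph (beta_dioph dc2 (unpair2_dioph dg2)) (lift_dioph dh)))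
      refine ball_dioph' (S := fun i w => Nat.beta (w none) (i+1) ∈
        f2 (Nat.pair (g (w ∘ some)).unpair.1 (Nat.pair i (Nat.beta (w none) i)))) (unpair2_dioph dg2) ?_
      exact ih2 _ _ (pair_dioph (unpair1_dioph dg3) (pair_dioph di3 (beta_dioph dc3 di3)))
        (beta_dioph dc3 (add_dioph di3 (const_dioph 1)))
    · exact (rec_iff_beta (f1 (g v).unpair.1)
        (fun y i => f2 (Nat.pair (g v).unpair.1 (Nat.pair y i))) (h v) (g v).unpair.2).symm
  | rfind _ ih =>
    rename_i f1 _
    intro α g h dg dh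
    refine Dioph.ext (Dioph.inter (ih (fun v => Nat.pair (g v) (h v)) (fun _ => 0)
      (pair_dioph dg dh) (const_dioph 0))
      (ball_dioph' (S := fun k v => ∃ y, y ∈ f1 (Nat.pair (g v) k) ∧ y ≠ 0) dh
        (ex_dioph' (S := fun y w => y ∈ f1 (Nat.pair (g (w ∘ some)) (w none)) ∧ y ≠ 0)
        ((ih _ _ (pair_dioph (lift_dioph (lift_dioph dg)) (lift_dioph (proj_dioph none)))
          (proj_dioph none)).inter (ne_dioph (proj_dioph none) (const_dioph 0)))))) fun v => ?_
    refine Iff.trans ?_ Nat.mem_rfind.symm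
    simp

theorem poly_to_mv {γ : Type} (p : Poly γ) :
    ∃ P : MvPolynomial γ ℤ, ∀ x : γ → ℕ, MvPolynomial.eval (fun c => (x c : ℤ)) P = p x := by
  induction p using Poly.induction with
  | H1 i => exact ⟨MvPolynomial.X i, fun x => by simp⟩
  | H2 n => exact ⟨MvPolynomial.C n, fun x => by simp⟩
  | H3 p q hp hq =>
    obtain ⟨P, hP⟩ := hp
    obtain ⟨R, hR⟩ := hq
    exact ⟨P - R, fun x => by simp [hP, hR]⟩
  | H4 p q hp hq =>
    obtain ⟨P, hP⟩ := hp
    obtain ⟨R, hR⟩ := hq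
    exact ⟨P * R, fun x => by simp [hP, hR]⟩

theorem dioph_to_mv {S : ℕ → Prop} (d : Dioph {v : Unit → ℕ | S (v ())}) :
    ∃ (n : ℕ) (p : MvPolynomial (Fin (n + 1)) ℤ), ∀ a : ℕ, S a ↔ ∃ x : Fin n → ℕ,
        MvPolynomial.eval (Fin.cons (a : ℤ) (fun i => ((x i : ℕ) : ℤ))) p = 0 := by
  obtain ⟨n, p, hp⟩ := fin_dummies d
  obtain ⟨P, hP⟩ := poly_to_mv (p.map (Sum.elim (fun _ => (0 : Fin (n+1))) Fin.succ))
  refine ⟨n, P, fun a => (hp (fun _ => a)).trans (exists_congr fun x => ?_)⟩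
  have e : (Fin.cons (a : ℤ) (fun i => ((x i : ℕ) : ℤ)) : Fin (n+1) → ℤ) =
      fun c => (((Fin.cons a x : Fin (n+1) → ℕ) c : ℕ) : ℤ) := by
    funext c
    refine Fin.cases ?_ (fun i => ?_) c <;> simp
  rw [e, hP, Poly.map_apply]
  have e2 : (Fin.cons a x : Fin (n+1) → ℕ) ∘ (Sum.elim (fun _ => (0 : Fin (n+1))) Fin.succ) =
      Sum.elim (fun _ : Unit => a) x := by
    funext c
    rcases c with c | c <;> simp
  rw [e2]

theorem halting_nat : ¬ ComputablePred fun a : ℕ =>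
    (Nat.Partrec.Code.eval (Denumerable.ofNat Nat.Partrec.Code a) 0).Dom := by
  intro h
  refine ComputablePred.halting_problem 0 ?_
  have := h.computable_of_manyOneReducible
    (p := fun c : Nat.Partrec.Code => (Nat.Partrec.Code.eval c 0).Dom)
    ⟨Encodable.encode, Computable.encode, fun c => by simp⟩
  exact this

theorem halting_partrec : Nat.Partrec fun a : ℕ =>
    Nat.Partrec.Code.eval (Denumerable.ofNat Nat.Partrec.Code a) 0 :=
  Partrec.nat_iff.1
    (Nat.Partrec.Code.eval_part.comp (Computable.ofNat Nat.Partrec.Code) (Computable.const 0))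

end H10

/-- Negative solution to Hilbert's Tenth Problem in parametric form:
there is a Diophantine set that is not computable. -/
theorem exists_noncomputable_diophantine_set :
    ∃ (n : ℕ) (p : MvPolynomial (Fin (n + 1)) ℤ),
      ¬ ComputablePred (fun a : ℕ => ∃ x : Fin n → ℕ,
        MvPolynomial.eval (Fin.cons (a : ℤ) (fun i => ((x i : ℕ) : ℤ))) p = 0) := by
  have d : Dioph {v : Unit → ℕ |
      (Nat.Partrec.Code.eval (Denumerable.ofNat Nat.Partrec.Code (v ())) 0).Dom} :=
    Dioph.ext (H10.ex_dioph' (S := fun y v =>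
      y ∈ Nat.Partrec.Code.eval (Denumerable.ofNat Nat.Partrec.Code (v ())) 0)
      (H10.partrec_dioph H10.halting_partrec (fun w => w (some ())) (fun w => w none)
        (Dioph.proj_dioph _) (Dioph.proj_dioph _))) fun v => Part.dom_iff_mem.symm
  obtain ⟨n, p, hp⟩ := H10.dioph_to_mv (S := fun a =>
    (Nat.Partrec.Code.eval (Denumerable.ofNat Nat.Partrec.Code a) 0).Dom) d
  refine ⟨n, p, fun h => H10.halting_nat ?_⟩
  rwa [show (fun a : ℕ => (Nat.Partrec.Code.eval (Denumerable.ofNat Nat.Partrec.Code a) 0).Dom) = _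
    from funext fun a => propext (hp a)]
end

section
/- The collection of Diophantine subsets of ℕ is not closed under complements: there exists a Diophantine set S ⊆ ℕ such that the complement ℕ \ S is not Diophantine. -/
/-- A set `S ⊆ ℕ` is Diophantine if membership in `S` is defined by an
existential polynomial formula over ℕ with integer coefficients. -/
def IsDiophantine (S : Set ℕ) : Prop :=
  ∃ (n : ℕ) (p : MvPolynomial (Fin (n + 1)) ℤ),
    ∀ a : ℕ, a ∈ S ↔ ∃ x : Fin n → ℕ,
      MvPolynomial.eval (Fin.cons (a : ℤ) (fun i => ((x i : ℕ) : ℤ))) p = 0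

namespace DavisProof

open scoped Dioph

/-! ### Gödel coding -/

/-- Gödel beta function with two parameters. -/
def B (u w i : ℕ) : ℕ := u % ((i + 1) * w + 1)

/-- A polynomial injection `ℕ × ℕ → ℕ`. -/
def P (a b : ℕ) : ℕ := (a + b) * (a + b) + a

theorem P_inj {a b c d : ℕ} (h : P a b = P c d) : a = c ∧ b = d := by
  unfold P at h
  have h1 : a + b = c + d := by
    rcases lt_trichotomy (a + b) (c + d) with h1 | h1 | h1
    · exfalso; nlinarith
    · exact h1
    · exfalso; nlinarith
  rw [h1] at h
  omega

theorem exists_B (N : ℕ) (s : ℕ → ℕ) : ∃ u w, ∀ i < N, B u w i = s i := by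
  let l := (List.range N).map s
  refine ⟨(Nat.unbeta l).unpair.1, (Nat.unbeta l).unpair.2, fun i hi => ?_⟩
  have hl : i < l.length := by simpa [l] using hi
  have := Nat.beta_unbeta_coe l ⟨i, hl⟩
  simpa [Nat.beta, B, l] using this

section
variable {α : Type} {f g h : (α → ℕ) → ℕ}

theorem B_dioph (df : Dioph.DiophFn f) (dg : Dioph.DiophFn g) (dh : Dioph.DiophFn h) :
    Dioph.DiophFn fun v => B (f v) (g v) (h v) :=
  df D% ((dh D+ D.1) D* dg D+ D.1)

theorem P_dioph (df : Dioph.DiophFn f) (dg : Dioph.DiophFn g) :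
    Dioph.DiophFn fun v => P (f v) (g v) :=
  (df D+ dg) D* (df D+ dg) D+ df

end

/-! ### Register constraints -/

/-- The constraint `x i * x j + x k + c = x l`. -/
structure Ins where
  i : ℕ
  j : ℕ
  k : ℕ
  c : ℕ
  l : ℕ

/-- `x` satisfies the constraint. -/
def Ins.holds (I : Ins) (x : ℕ → ℕ) : Prop := x I.i * x I.j + x I.k + I.c = x I.l

/-- There is a list of constraints which, given the input registers below `n0`,
says exactly that registers below `N` have values `F`. -/
def Good (n0 N : ℕ) (F : (ℕ → ℕ) → ℕ → ℕ) : Prop :=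
  ∃ L : List Ins, ∀ x y : ℕ → ℕ, (∀ i < n0, x i = y i) →
    ((∀ I ∈ L, I.holds x) ↔ ∀ l < N, x l = F y l)

theorem good_base (n0 : ℕ) : Good n0 n0 (fun y => y) :=
  ⟨[], fun x y h => by simpa using h⟩

theorem good_step {n0 N : ℕ} {F : (ℕ → ℕ) → ℕ → ℕ} (h : Good n0 N F) (i j k c : ℕ)
    (hi : i < N) (hj : j < N) (hk : k < N) :
    ∃ F', Good n0 (N + 1) F' ∧ (∀ y, ∀ l < N, F' y l = F y l) ∧
      ∀ y, F' y N = F y i * F y j + F y k + c := by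
  obtain ⟨L, hL⟩ := h
  refine ⟨fun y => Function.update (F y) N (F y i * F y j + F y k + c),
    ⟨⟨i, j, k, c, N⟩ :: L, fun x y hxy => ?_⟩, ?_, ?_⟩
  · rw [List.forall_mem_cons, hL x y hxy]
    simp only [Ins.holds]
    constructor
    · rintro ⟨h1, h2⟩ l hl
      rcases Nat.lt_succ_iff_lt_or_eq.1 hl with hl | rfl
      · rw [Function.update_of_ne hl.ne]; exact h2 l hl
      · rw [Function.update_self, ← h1, h2 i hi, h2 j hj, h2 k hk]
    · intro h1
      have h2 : ∀ l < N, x l = F y l := fun l hl => by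
        rw [h1 l (by omega), Function.update_of_ne hl.ne]
      refine ⟨?_, h2⟩
      rw [h1 N (by omega), Function.update_self, h2 i hi, h2 j hj, h2 k hk]
  · intro y l hl
    simp only
    rw [Function.update_of_ne hl.ne]
  · intro y
    simp only
    rw [Function.update_self]

/-- Every polynomial can be computed by an extension. -/
theorem good_poly {σ : Type} (r : σ → ℕ) {n0 : ℕ} (hr : ∀ i, r i < n0) (h3 : 3 ≤ n0)
    (p : MvPolynomial σ ℤ) : ∀ {N : ℕ} {F : (ℕ → ℕ) → ℕ → ℕ}, Good n0 N F → n0 ≤ N →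
    (∀ y, ∀ l < n0, F y l = y l) →
    ∃ N' F' o o', N ≤ N' ∧ Good n0 N' F' ∧ (∀ y, ∀ l < N, F' y l = F y l) ∧ o < N' ∧ o' < N' ∧
      ∀ y : ℕ → ℕ, y 1 = 1 → y 2 = 0 →
        MvPolynomial.eval (fun i => (y (r i) : ℤ)) p = (F' y o : ℤ) - F' y o' := by
  have key : ∀ {N : ℕ} {F : (ℕ → ℕ) → ℕ → ℕ}, Good n0 N F → ∀ i j k c i' j' k' c' : ℕ,
      i < N → j < N → k < N → i' < N + 1 → j' < N + 1 → k' < N + 1 →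
      ∃ F', Good n0 (N + 2) F' ∧ (∀ y, ∀ l < N, F' y l = F y l) ∧
      (∀ y, F' y N = F y i * F y j + F y k + c) ∧
      (∀ y, F' y (N + 1) = F' y i' * F' y j' + F' y k' + c') := by
    intro N F h i j k c i' j' k' c' hi hj hk hi' hj' hk'
    obtain ⟨F1, g1, a1, b1⟩ := good_step h i j k c hi hj hk
    obtain ⟨F2, g2, a2, b2⟩ := good_step g1 i' j' k' c' hi' hj' hk'
    refine ⟨F2, g2, fun y l hl => ?_, fun y => ?_, fun y => ?_⟩
    · rw [a2 y l (by omega), a1 y l hl]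
    · rw [a2 y N (by omega), b1]
    · rw [b2, a2 y _ hi', a2 y _ hj', a2 y _ hk']
  induction p using MvPolynomial.induction_on with
  | C a =>
    intro N F h hN hb
    obtain ⟨F', g, e, b, b'⟩ := key h 2 2 2 a.toNat 2 2 2 (-a).toNat
      (by omega) (by omega) (by omega) (by omega) (by omega) (by omega)
    refine ⟨N + 2, F', N, N + 1, by omega, g, e, by omega, by omega, fun y h1 h2 => ?_⟩
    rw [b, b', e y 2 (by omega), hb y 2 (by omega), h2]
    simp
  | add p q ihp ihq =>
    intro N F h hN hb
    obtain ⟨N1, F1, a, a', l1, g1, e1, ha, ha', v1⟩ := ihp h hN hb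
    have hb1 : ∀ y, ∀ l < n0, F1 y l = y l := fun y l hl => by
      rw [e1 y l (by omega), hb y l hl]
    obtain ⟨N2, F2, b, b', l2, g2, e2, hb2, hb2', v2⟩ := ihq g1 (by omega) hb1
    obtain ⟨F3, g3, e3, w, w'⟩ := key g2 a 1 b 0 a' 1 b' 0
      (by omega) (by omega) (by omega) (by omega) (by omega) (by omega)
    refine ⟨N2 + 2, F3, N2, N2 + 1, by omega, g3, fun y l hl => ?_, by omega, by omega,
      fun y h1 h2 => ?_⟩
    · rw [e3 y l (by omega), e2 y l (by omega), e1 y l hl]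
    · have q1 : F2 y 1 = 1 := by rw [e2 y 1 (by omega), hb1 y 1 (by omega), h1]
      rw [w, w', e3 y a' (by omega), e3 y b' hb2', e3 y 1 (by omega), q1, map_add, v1 y h1 h2,
        v2 y h1 h2, e2 y a ha, e2 y a' ha']
      push_cast
      ring
  | mul_X p i ihp =>
    intro N F h hN hb
    obtain ⟨N1, F1, a, a', l1, g1, e1, ha, ha', v1⟩ := ihp h hN hb
    have hb1 : ∀ y, ∀ l < n0, F1 y l = y l := fun y l hl => by
      rw [e1 y l (by omega), hb y l hl]
    have hri := hr i
    obtain ⟨F3, g3, e3, w, w'⟩ := key g1 a (r i) 2 0 a' (r i) 2 0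
      (by omega) (by omega) (by omega) (by omega) (by omega) (by omega)
    refine ⟨N1 + 2, F3, N1, N1 + 1, by omega, g3, fun y l hl => ?_, by omega, by omega,
      fun y h1 h2 => ?_⟩
    · rw [e3 y l (by omega), e1 y l hl]
    · have q1 : F1 y 2 = 0 := by rw [hb1 y 2 (by omega), h2]
      rw [w, w', e3 y a' (by omega), e3 y (r i) (by omega), e3 y 2 (by omega), q1, map_mul,
        v1 y h1 h2, hb1 y _ hri, MvPolynomial.eval_X]
      push_cast
      ring

/-- Diophantine sets are given by lists of constraints. -/
theorem exists_list {S : Set ℕ} (hS : IsDiophantine S) :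
    ∃ L : List Ins, ∀ a, a ∈ S ↔
      ∃ x : ℕ → ℕ, x 0 = a ∧ x 1 = 1 ∧ x 2 = 0 ∧ ∀ I ∈ L, I.holds x := by
  obtain ⟨n, p, hp⟩ := hS
  let r : Fin (n + 1) → ℕ := Fin.cons 0 (fun i => i + 3)
  have hr : ∀ i, r i < n + 3 := by
    intro i
    refine Fin.cases ?_ (fun i => ?_) i
    · simp [r]
    · simp [r]
  have hcons : ∀ (y : ℕ → ℕ), (fun i => ((y (r i) : ℕ) : ℤ)) =
      Fin.cons ((y 0 : ℕ) : ℤ) (fun i : Fin n => ((y (i + 3) : ℕ) : ℤ)) := by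
    intro y
    funext i
    refine Fin.cases ?_ (fun i => ?_) i <;> simp [r]
  obtain ⟨N, F, o, o', hN, ⟨L, hL⟩, he, ho, ho', hv⟩ :=
    good_poly r hr (by omega) p (good_base (n + 3)) le_rfl (fun _ _ _ => rfl)
  refine ⟨⟨o, 1, 2, 0, o'⟩ :: L, fun a => ?_⟩
  rw [hp]
  constructor
  · rintro ⟨t, ht⟩
    let y : ℕ → ℕ := fun m => if m = 0 then a else if m = 1 then 1 else if m = 2 then 0 else
      if h : m - 3 < n then t ⟨m - 3, h⟩ else 0
    have hx : ∀ l < n + 3, F y l = y l := he y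
    have h1 : F y 1 = 1 := by rw [hx 1 (by omega)]; simp [y]
    have h2 : F y 2 = 0 := by rw [hx 2 (by omega)]; simp [y]
    refine ⟨F y, by rw [hx 0 (by omega)]; simp [y], h1, h2, ?_⟩
    rw [List.forall_mem_cons]
    refine ⟨?_, (hL (F y) y hx).2 fun _ _ => rfl⟩
    have := hv y (by simp [y]) (by simp [y])
    rw [hcons] at this
    have e : (Fin.cons ((y 0 : ℕ) : ℤ) (fun i : Fin n => ((y (i + 3) : ℕ) : ℤ)) : Fin (n+1) → ℤ) =
        Fin.cons (a : ℤ) (fun i => ((t i : ℕ) : ℤ)) := by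
      simp [y]
    rw [e, ht] at this
    simp only [Ins.holds, h1, h2]
    omega
  · rintro ⟨x, h0, h1, h2, hx⟩
    rw [List.forall_mem_cons] at hx
    obtain ⟨hI, hx⟩ := hx
    have hF := (hL x x fun _ _ => rfl).1 hx
    have := hv x h1 h2
    rw [hcons, h0] at this
    refine ⟨fun i => x (i + 3), ?_⟩
    rw [this, ← hF o ho, ← hF o' ho']
    simp only [Ins.holds, h1, h2] at hI
    omega

theorem exists_bound (L : List Ins) :
    ∃ M, 3 ≤ M ∧ ∀ I ∈ L, I.i < M ∧ I.j < M ∧ I.k < M ∧ I.l < M := by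
  induction L with
  | nil => exact ⟨3, le_rfl, by simp⟩
  | cons I L ih =>
    obtain ⟨M, h3, hM⟩ := ih
    refine ⟨M + I.i + I.j + I.k + I.l + 1, by omega, ?_⟩
    rw [List.forall_mem_cons]
    refine ⟨by omega, fun J hJ => ?_⟩
    have := hM J hJ
    omega

/-- The `t`-th coded constraint, applied to the sequence coded by `p, q`, holds. -/
def R (u w p q t : ℕ) : Prop :=
  B p q (B u w (5 * t)) * B p q (B u w (5 * t + 1)) + B p q (B u w (5 * t + 2)) +
    B u w (5 * t + 3) = B p q (B u w (5 * t + 4))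

/-- Every Diophantine set has a Gödel code. -/
theorem exists_code {S : Set ℕ} (hS : IsDiophantine S) :
    ∃ m u w, ∀ a, a ∈ S ↔
      ∃ p q, B p q 0 = a ∧ B p q 1 = 1 ∧ B p q 2 = 0 ∧ ∀ t < m, R u w p q t := by
  obtain ⟨L, hL⟩ := exists_list hS
  obtain ⟨M, h3, hM⟩ := exists_bound L
  let g : ℕ → Ins := fun t => L.getD t ⟨0, 0, 0, 0, 0⟩
  obtain ⟨u, w, hc⟩ := exists_B (5 * L.length) (fun n =>
    if n % 5 = 0 then (g (n / 5)).i else if n % 5 = 1 then (g (n / 5)).j else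
    if n % 5 = 2 then (g (n / 5)).k else if n % 5 = 3 then (g (n / 5)).c else (g (n / 5)).l)
  have key : ∀ p q, (∀ t < L.length, R u w p q t) ↔ ∀ I ∈ L, I.holds (B p q) := by
    intro p q
    rw [List.forall_mem_iff_getElem]
    refine forall₂_congr fun t ht => ?_
    have d0 : 5 * t / 5 = t := by omega
    have d1 : (5 * t + 1) / 5 = t := by omega
    have d2 : (5 * t + 2) / 5 = t := by omega
    have d3 : (5 * t + 3) / 5 = t := by omega
    have d4 : (5 * t + 4) / 5 = t := by omega
    have m0 : 5 * t % 5 = 0 := by omega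
    have m1 : (5 * t + 1) % 5 = 1 := by omega
    have m2 : (5 * t + 2) % 5 = 2 := by omega
    have m3 : (5 * t + 3) % 5 = 3 := by omega
    have m4 : (5 * t + 4) % 5 = 4 := by omega
    have hg : g t = L[t] := by simp [g, ht]
    unfold R Ins.holds
    rw [hc (5 * t) (by omega), hc (5 * t + 1) (by omega), hc (5 * t + 2) (by omega),
      hc (5 * t + 3) (by omega), hc (5 * t + 4) (by omega)]
    simp [d0, d1, d2, d3, d4, m0, m1, m2, m3, m4, hg]
  refine ⟨L.length, u, w, fun a => ?_⟩
  rw [hL]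
  constructor
  · rintro ⟨x, h0, h1, h2, hx⟩
    obtain ⟨p, q, hpq⟩ := exists_B M x
    refine ⟨p, q, by rw [hpq _ (by omega), h0], by rw [hpq _ (by omega), h1],
      by rw [hpq _ (by omega), h2], (key p q).2 fun I hI => ?_⟩
    obtain ⟨a1, a2, a3, a4⟩ := hM I hI
    unfold Ins.holds
    rw [hpq _ a1, hpq _ a2, hpq _ a3, hpq _ a4]
    exact hx I hI
  · rintro ⟨p, q, h0, h1, h2, h⟩
    exact ⟨B p q, h0, h1, h2, (key p q).1 h⟩

/-! ### Comparison with Mathlib's `Dioph` -/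

theorem exists_mvPolynomial {α : Type} {f : (α → ℕ) → ℤ} (hf : IsPoly f) :
    ∃ p : MvPolynomial α ℤ, ∀ x, f x = MvPolynomial.eval (fun i => (x i : ℤ)) p := by
  induction hf with
  | proj i => exact ⟨MvPolynomial.X i, by simp⟩
  | const n => exact ⟨MvPolynomial.C n, by simp⟩
  | sub _ _ h1 h2 =>
    obtain ⟨p, hp⟩ := h1
    obtain ⟨q, hq⟩ := h2
    exact ⟨p - q, by simp [hp, hq]⟩
  | mul _ _ h1 h2 =>
    obtain ⟨p, hp⟩ := h1
    obtain ⟨q, hq⟩ := h2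
    exact ⟨p * q, by simp [hp, hq]⟩

theorem isDiophantine_of_dioph {S : Set ℕ} (h : Dioph {v : Vector3 ℕ 1 | v (Fin2.ofNat' 0) ∈ S}) :
    IsDiophantine S := by
  classical
  obtain ⟨β, p, hp⟩ := h
  obtain ⟨q, hq⟩ := exists_mvPolynomial p.isPoly
  obtain ⟨n, f, hf, q', rfl⟩ := MvPolynomial.exists_fin_rename q
  let k : Fin n → Fin (n + 1) := fun i => Sum.elim (fun _ => 0) (fun _ => i.succ) (f i)
  refine ⟨n, MvPolynomial.rename k q', fun a => ?_⟩
  have h1 : a ∈ S ↔ _ := hp (fun _ => a)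
  rw [h1]
  simp only [hq, MvPolynomial.eval_rename]
  constructor
  · rintro ⟨t, ht⟩
    refine ⟨fun i => Sum.elim (fun _ => 0) t (f i), ?_⟩
    rw [← ht]
    congr 2
    funext i
    simp only [Function.comp, k]
    rcases hfi : f i with b | b <;> simp [hfi]
  · rintro ⟨x, hx⟩
    refine ⟨fun b => if h : ∃ i, f i = Sum.inr b then x h.choose else 0, ?_⟩
    rw [← hx]
    congr 2
    funext i
    simp only [Function.comp, k]
    rcases hfi : f i with b | b
    · simp
    · have hex : ∃ i, f i = Sum.inr b := ⟨i, hfi⟩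
      have : hex.choose = i := hf (hex.choose_spec.trans hfi.symm)
      simp [hex, this]

theorem isPoly_of_mvPolynomial {α : Type} (p : MvPolynomial α ℤ) :
    IsPoly fun x : α → ℕ => MvPolynomial.eval (fun i => (x i : ℤ)) p := by
  induction p using MvPolynomial.induction_on with
  | C a => simpa using IsPoly.const a
  | add p q hp hq => simpa using! IsPoly.add hp hq
  | mul_X p i hp => simpa using IsPoly.mul hp (IsPoly.proj i)

theorem dioph_of_isDiophantine {S : Set ℕ} (h : IsDiophantine S) :
    Dioph {v : Vector3 ℕ 1 | v (Fin2.ofNat' 0) ∈ S} := by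
  obtain ⟨n, p, hp⟩ := h
  let k : Fin (n + 1) → Fin2 1 ⊕ Fin n := Fin.cons (Sum.inl (Fin2.ofNat' 0)) Sum.inr
  refine ⟨Fin n, ⟨_, isPoly_of_mvPolynomial (MvPolynomial.rename k p)⟩, fun v => ?_⟩
  refine (hp (v (Fin2.ofNat' 0))).trans ?_
  refine exists_congr fun t => ?_
  change _ ↔ MvPolynomial.eval (fun i => ((Sum.elim v t i : ℕ) : ℤ)) (MvPolynomial.rename k p) = 0
  rw [MvPolynomial.eval_rename]
  have : (Fin.cons ((v (Fin2.ofNat' 0) : ℕ) : ℤ) (fun i => ((t i : ℕ) : ℤ)) : Fin (n+1) → ℤ) =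
      (fun i => ((Sum.elim v t i : ℕ) : ℤ)) ∘ k := by
    funext i
    refine Fin.cases ?_ (fun i => ?_) i <;> simp [k]
  rw [this]

open scoped Vector3

/-! ### The two Diophantine sets -/

/-- Codes of a program together with a sequence violating it. -/
def W : Set ℕ := {n | ∃ m u w p q t, n = P (P m (P u w)) (P p q) ∧ t < m ∧ ¬ R u w p q t}

theorem W_dioph : IsDiophantine W := by
  apply isDiophantine_of_dioph
  exact ((D∃) 1 <| (D∃) 2 <| (D∃) 3 <| (D∃) 4 <| (D∃) 5 <| (D∃) 6 <|
    (D&6 D= P_dioph (P_dioph (D&5) (P_dioph (D&4) (D&3))) (P_dioph (D&2) (D&1))) D∧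
    (D&0 D< D&5) D∧
    (B_dioph (D&2) (D&1) (B_dioph (D&4) (D&3) (D.5 D* D&0)) D*
      B_dioph (D&2) (D&1) (B_dioph (D&4) (D&3) (D.5 D* D&0 D+ D.1)) D+
      B_dioph (D&2) (D&1) (B_dioph (D&4) (D&3) (D.5 D* D&0 D+ D.2)) D+
      B_dioph (D&4) (D&3) (D.5 D* D&0 D+ D.3) D≠
      B_dioph (D&2) (D&1) (B_dioph (D&4) (D&3) (D.5 D* D&0 D+ D.4))) :)

/-- Codes of programs accepting their own code. -/
def K : Set ℕ := {e | ∃ m u w p q, e = P m (P u w) ∧ P e (P p q) ∈ Wᶜ ∧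
  B p q 0 = e ∧ B p q 1 = 1 ∧ B p q 2 = 0}

theorem K_dioph (h : IsDiophantine Wᶜ) : IsDiophantine K := by
  apply isDiophantine_of_dioph
  have hW : ∀ {n : ℕ} {f : Vector3 ℕ n → ℕ}, Dioph.DiophFn f →
      Dioph {v : Vector3 ℕ n | f v ∈ Wᶜ} := fun {n f} df =>
    Dioph.dioph_comp (dioph_of_isDiophantine h) [f] df
  exact ((D∃) 1 <| (D∃) 2 <| (D∃) 3 <| (D∃) 4 <| (D∃) 5 <|
    (D&5 D= P_dioph (D&4) (P_dioph (D&3) (D&2))) D∧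
    (hW (P_dioph (D&5) (P_dioph (D&1) (D&0)))) D∧
    (B_dioph (D&1) (D&0) (D.0) D= D&5) D∧
    (B_dioph (D&1) (D&0) (D.1) D= D.1) D∧
    (B_dioph (D&1) (D&0) (D.2) D= D.0) :)

theorem mem_K (m u w : ℕ) : P m (P u w) ∈ K ↔
    ∃ p q, B p q 0 = P m (P u w) ∧ B p q 1 = 1 ∧ B p q 2 = 0 ∧ ∀ t < m, R u w p q t := by
  constructor
  · rintro ⟨m', u', w', p, q, -, hW, h0, h1, h2⟩
    refine ⟨p, q, h0, h1, h2, fun t ht => ?_⟩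
    by_contra hR
    exact hW ⟨m, u, w, p, q, t, rfl, ht, hR⟩
  · rintro ⟨p, q, h0, h1, h2, h⟩
    refine ⟨m, u, w, p, q, rfl, ?_, h0, h1, h2⟩
    rintro ⟨m', u', w', p', q', t, he, ht, hR⟩
    obtain ⟨ha, hb⟩ := P_inj he
    obtain ⟨rfl, hc⟩ := P_inj ha
    obtain ⟨rfl, rfl⟩ := P_inj hc
    obtain ⟨rfl, rfl⟩ := P_inj hb
    exact hR (h t ht)

end DavisProof

/-- Davis (1953): the collection of Diophantine subsets of ℕ is not closed
under complements. -/
theorem diophantine_not_closed_under_complement :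
    ∃ S : Set ℕ, IsDiophantine S ∧ ¬ IsDiophantine Sᶜ := by
  by_contra! hcl
  have hK := hcl _ (DavisProof.K_dioph (hcl _ DavisProof.W_dioph))
  obtain ⟨m, u, w, h⟩ := DavisProof.exists_code hK
  have h1 := h (DavisProof.P m (DavisProof.P u w))
  rw [← DavisProof.mem_K, Set.mem_compl_iff] at h1
  tauto
end

section
/- If S ⊆ ℕ is a computable set, then both S and its complement ℕ \ S are Diophantine; that is, each of S and ℕ \ S admits a representation by an existential polynomial formula over ℕ. -/
namespace MRDP
open Fin2 Function Nat Sum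


/-- Dummy variables may be taken from a finite type. -/
theorem isPoly_support {α β : Type} {f : (α ⊕ β → ℕ) → ℤ} (hf : IsPoly f) :
    ∃ s : Finset β, ∀ v t t', (∀ i ∈ s, t i = t' i) → f (Sum.elim v t) = f (Sum.elim v t') := by
  classical
  induction hf with
  | proj i =>
    rcases i with i | i
    · exact ⟨∅, fun v t t' _ => by simp⟩
    · exact ⟨{i}, fun v t t' h => by simp [h i]⟩
  | const n => exact ⟨∅, fun v t t' _ => rfl⟩
  | sub _ _ ih1 ih2 =>
    obtain ⟨s1, h1⟩ := ih1
    obtain ⟨s2, h2⟩ := ih2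
    refine ⟨s1 ∪ s2, fun v t t' h => ?_⟩
    dsimp only
    rw [h1 v t t' fun i hi => h i (Finset.mem_union_left _ hi),
      h2 v t t' fun i hi => h i (Finset.mem_union_right _ hi)]
  | mul _ _ ih1 ih2 =>
    obtain ⟨s1, h1⟩ := ih1
    obtain ⟨s2, h2⟩ := ih2
    refine ⟨s1 ∪ s2, fun v t t' h => ?_⟩
    dsimp only
    rw [h1 v t t' fun i hi => h i (Finset.mem_union_left _ hi),
      h2 v t t' fun i hi => h i (Finset.mem_union_right _ hi)]

theorem dioph_finite {α : Type} {S : Set (α → ℕ)} (h : Dioph S) :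
    ∃ (n : ℕ) (p : Poly (α ⊕ Fin n)), ∀ v, v ∈ S ↔ ∃ t, p (Sum.elim v t) = 0 := by
  classical
  obtain ⟨β, p, hp⟩ := h
  obtain ⟨s, hs⟩ := isPoly_support p.isPoly
  let e := Fintype.equivFin (Option s)
  let g : β → Option s := fun b => if h : b ∈ s then some ⟨b, h⟩ else none
  refine ⟨_, p.map (Sum.elim inl (inr ∘ e ∘ g)), fun v => (hp v).trans ⟨?_, ?_⟩⟩
  · rintro ⟨t, ht⟩
    refine ⟨fun i => (e.symm i).elim 0 (fun b => t b), ?_⟩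
    rw [← ht, Poly.map_apply]
    have : (Sum.elim v (fun i => (e.symm i).elim 0 (fun b => t b)) ∘ Sum.elim inl (inr ∘ e ∘ g))
        = Sum.elim v (fun b => (g b).elim 0 (fun b => t b)) := by
      funext x; rcases x with x | x <;> simp
    rw [this]
    apply hs
    intro i hi
    simp [g, hi]
  · rintro ⟨t, ht⟩
    refine ⟨t ∘ e ∘ g, ?_⟩
    rw [← ht, Poly.map_apply]
    congr 1
    funext x; rcases x with x | x <;> simp

theorem isPoly_mv {α : Type} {f : (α → ℕ) → ℤ} (hf : IsPoly f) :
    ∃ p : MvPolynomial α ℤ, ∀ v, MvPolynomial.eval (fun i => (v i : ℤ)) p = f v := by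
  induction hf with
  | proj i => exact ⟨.X i, by simp⟩
  | const n => exact ⟨.C n, by simp⟩
  | sub _ _ ih1 ih2 =>
    obtain ⟨p, hp⟩ := ih1
    obtain ⟨q, hq⟩ := ih2
    exact ⟨p - q, by simp [hp, hq]⟩
  | mul _ _ ih1 ih2 =>
    obtain ⟨p, hp⟩ := ih1
    obtain ⟨q, hq⟩ := ih2
    exact ⟨p * q, by simp [hp, hq]⟩

theorem isPoly_bound {α : Type} {f : (α → ℕ) → ℤ} (hf : IsPoly f) :
    ∃ C d : ℕ, ∀ (v : α → ℕ) (w : ℕ), (∀ i, v i ≤ w) → (f v).natAbs ≤ C * (w + 1) ^ d := by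
  induction hf with
  | proj i => exact ⟨1, 1, fun v w h => by simpa using (h i).trans (Nat.le_succ w)⟩
  | const n => exact ⟨n.natAbs, 0, fun v w h => by simp⟩
  | sub _ _ ih1 ih2 =>
    obtain ⟨C, d, h1⟩ := ih1
    obtain ⟨D, e, h2⟩ := ih2
    refine ⟨C + D, d + e, fun v w h => (Int.natAbs_sub_le _ _).trans ?_⟩
    rw [add_mul]
    refine Nat.add_le_add ((h1 v w h).trans ?_) ((h2 v w h).trans ?_) <;> gcongr <;> omega
  | mul _ _ ih1 ih2 =>
    obtain ⟨C, d, h1⟩ := ih1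
    obtain ⟨D, e, h2⟩ := ih2
    refine ⟨C * D, d + e, fun v w h => ?_⟩
    rw [Int.natAbs_mul, pow_add, mul_mul_mul_comm]
    exact Nat.mul_le_mul (h1 v w h) (h2 v w h)

theorem isPoly_congr {α : Type} {f : (α → ℕ) → ℤ} (hf : IsPoly f) (m : ℕ) (v w : α → ℕ)
    (h : ∀ i, v i ≡ w i [MOD m]) : f v ≡ f w [ZMOD m] := by
  induction hf with
  | proj i => exact (Int.natCast_modEq_iff).2 (h i)
  | const n => rfl
  | sub _ _ ih1 ih2 => exact ih1.sub ih2
  | mul _ _ ih1 ih2 => exact ih1.mul ih2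

open Dioph

theorem forall_dioph {α : Type} {n : ℕ} {S : Fin n → Set (α → ℕ)} (h : ∀ i, Dioph (S i)) :
    Dioph {v | ∀ i, v ∈ S i} := by
  induction n with
  | zero => exact Dioph.ext (eq_dioph (const_dioph 0) (const_dioph 0)) (by simp)
  | succ n ih =>
    refine Dioph.ext ((h 0).inter (ih fun i => h i.succ)) fun v => ?_
    simp [Fin.forall_fin_succ]

/-! ### Binomial coefficients and factorials -/

theorem choose_eq (n k B : ℕ) (hB : 2 ^ n < B) :
    n.choose k = ((B + 1) ^ n / B ^ k) % B := by
  have hB0 : 0 < B := (Nat.zero_le _).trans_lt hB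
  have key : ∀ k, ∃ r c, (B + 1) ^ n = r + B ^ k * (n.choose k + B * c) ∧ r < B ^ k := by
    have hc : ∀ k, n.choose k < B := fun k => (Nat.choose_le_two_pow n k).trans_lt hB
    intro k
    have hs : (B + 1) ^ n = ∑ i ∈ Finset.range (n + 1 + (k + 1)), n.choose i * B ^ i := by
      rw [add_pow, Finset.sum_range_add _ (n + 1)]
      rw [Finset.sum_eq_zero (s := Finset.range (k+1))]
      · simp [mul_comm]
      · intro i _; rw [Nat.choose_eq_zero_of_lt (by omega), zero_mul]
    have hr : ∀ k, ∑ i ∈ Finset.range k, n.choose i * B ^ i < B ^ k := by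
      intro k
      induction k with
      | zero => simp
      | succ k ih =>
        rw [Finset.sum_range_succ, pow_succ]
        have := Nat.mul_le_mul_right (B ^ k) (Nat.succ_le_of_lt (hc k))
        nlinarith
    refine ⟨_, ∑ i ∈ Finset.range n, n.choose (k + 1 + i) * B ^ i, ?_, hr k⟩
    rw [hs, show n + 1 + (k + 1) = (k + 1) + n + 1 by ring, Finset.sum_range_succ,
      Nat.choose_eq_zero_of_lt (show n < k + 1 + n by omega), Finset.sum_range_add,
      Finset.sum_range_succ]
    rw [mul_add, Finset.mul_sum, Finset.mul_sum, zero_mul, add_zero, add_assoc, mul_comm (B ^ k)]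
    congr 2
    refine Finset.sum_congr rfl fun i _ => ?_
    ring
  obtain ⟨r, c, h, hr⟩ := key k
  rw [h, Nat.add_mul_div_left _ _ (by positivity), Nat.div_eq_of_lt hr, zero_add,
    Nat.add_mul_mod_self_left, Nat.mod_eq_of_lt ((Nat.choose_le_two_pow n k).trans_lt hB)]

theorem choose_dioph {α : Type} {f g : (α → ℕ) → ℕ} (df : DiophFn f) (dg : DiophFn g) :
    DiophFn fun v => (f v).choose (g v) := by
  have dB : DiophFn fun v => 2 ^ f v + 1 := add_dioph (pow_dioph (const_dioph 2) df) (const_dioph 1)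
  have := mod_dioph (div_dioph (pow_dioph (add_dioph dB (const_dioph 1)) df) (pow_dioph dB dg)) dB
  convert! this using 2 with v
  exact choose_eq _ _ _ (by omega)

theorem factorial_eq (n r : ℕ) (hr : (n ^ n + 1) * n ^ 2 < r) : n ! = r ^ n / r.choose n := by
  have hnr : n ≤ r := by nlinarith [Nat.zero_le (n^n), Nat.zero_le (n^2), Nat.zero_le (n^n * n^2), Nat.le_self_pow (two_ne_zero) n]
  symm
  rw [Nat.div_eq_iff (Nat.choose_pos hnr)]
  have h1 : n ! * r.choose n = r.descFactorial n := (Nat.descFactorial_eq_factorial_mul_choose r n).symm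
  refine ⟨?_, ?_⟩
  · rw [h1]; exact Nat.descFactorial_le_pow r n
  · have hp : 0 < r.choose n := Nat.choose_pos hnr
    suffices h : r ^ n < (n ! + 1) * r.choose n by
      rw [add_mul, one_mul] at h; omega
    have hf : 0 < n ! := Nat.factorial_pos n
    refine lt_of_mul_lt_mul_left (a := n !) ?_ (Nat.zero_le _)
    rw [mul_left_comm, h1]
    have h2 : (r + 1 - n) ^ n ≤ r.descFactorial n := Nat.pow_sub_le_descFactorial r n
    have h3 : ((r:ℝ) - n) ^ n ≤ r.descFactorial n := by
      refine le_trans ?_ (Nat.cast_le.2 h2)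
      push_cast [Nat.cast_sub (show n ≤ r + 1 by omega)]
      have : (n:ℝ) ≤ r := by exact_mod_cast hnr
      gcongr
      linarith
    have hr0 : 0 < r := by omega
    have hrR : (0:ℝ) < r := by exact_mod_cast hr0
    have h4 : (1 - (n:ℝ)^2 / r) * r ^ n ≤ ((r:ℝ) - n) ^ n := by
      have hb := one_add_mul_le_pow (a := -((n:ℝ) / r)) (by
        have : (n:ℝ)/r ≤ 1 := by rw [div_le_one hrR]; exact_mod_cast hnr
        linarith) n
      have : ((r:ℝ) - n) ^ n = (1 + -((n:ℝ)/r)) ^ n * r ^ n := by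
        rw [← mul_pow]; congr 1; field_simp; ring
      rw [this]
      gcongr
      refine le_trans (le_of_eq ?_) hb
      ring
    have h5 : (n ! : ℝ) * r ^ n < (n ! + 1) * ((1 - (n:ℝ)^2 / r) * r ^ n) := by
      rw [← mul_assoc]
      refine mul_lt_mul_of_pos_right ?_ (by positivity)
      have h6 : ((n ! : ℝ) + 1) * n ^ 2 < r := by
        have : (n ! + 1) * n ^ 2 < r := by
          refine lt_of_le_of_lt ?_ hr
          gcongr
          exact Nat.factorial_le_pow n
        exact_mod_cast this
      have h7 : ((n ! : ℝ) + 1) * ((n:ℝ) ^ 2 / r) < 1 := by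
        rw [← mul_div_assoc, div_lt_one hrR]; exact h6
      nlinarith
    have : (n ! : ℝ) * r ^ n < (n ! + 1) * r.descFactorial n :=
      h5.trans_le (mul_le_mul_of_nonneg_left (h4.trans h3) (by positivity))
    exact_mod_cast this

theorem factorial_dioph {α : Type} {f : (α → ℕ) → ℕ} (df : DiophFn f) :
    DiophFn fun v => (f v) ! := by
  have dr : DiophFn fun v => (f v ^ f v + 1) * f v ^ 2 + 1 :=
    add_dioph (mul_dioph (add_dioph (pow_dioph df df) (const_dioph 1))
      (pow_dioph df (const_dioph 2))) (const_dioph 1)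
  have := div_dioph (pow_dioph dr df) (choose_dioph dr df)
  convert! this using 2 with v
  exact factorial_eq _ _ (by omega)

/-! ### Bounded universal quantification -/

/-- The moduli: `(k+1) * modulus Q k = Q! * Q! - (k + 1)`. -/
def modulus (Q k : ℕ) : ℕ := Q ! * (Q ! / (k + 1)) - 1

theorem modulus_spec {Q k : ℕ} (hk : k + 1 ≤ Q) :
    (k + 1) * (modulus Q k + 1) = Q ! * Q ! := by
  have hd : k + 1 ∣ Q ! := Nat.dvd_factorial (by omega) hk
  have h1 : 0 < Q ! / (k + 1) := Nat.div_pos (Nat.le_of_dvd (Nat.factorial_pos _) hd) (by omega)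
  have h2 : 0 < Q ! * (Q ! / (k + 1)) := Nat.mul_pos (Nat.factorial_pos _) h1
  have h3 : modulus Q k + 1 = Q ! * (Q ! / (k + 1)) := by unfold modulus; omega
  rw [h3, mul_left_comm, Nat.mul_div_cancel' hd]

theorem modulus_sub {Q k : ℕ} (hk : k + 1 ≤ Q) :
    (k + 1) * modulus Q k = (Q ! * Q !) - 1 - k := by
  have := modulus_spec hk
  rw [mul_add] at this
  omega

theorem le_sub {Q k : ℕ} (hk : k + 1 ≤ Q) : k ≤ (Q ! * Q !) - 1 := by
  have := modulus_spec hk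
  rw [mul_add] at this
  omega

theorem modulus_modEq {Q k p : ℕ} (hk : k + 1 ≤ Q) (hp : p ∣ modulus Q k) :
    (Q ! * Q !) - 1 ≡ k [MOD p] := by
  refine ((Nat.modEq_iff_dvd' (le_sub hk)).2 ?_).symm
  rw [← modulus_sub hk]
  exact hp.mul_left _

theorem modulus_prime {Q k p : ℕ} (hk : k + 1 ≤ Q) (hp : p.Prime) (h : p ∣ modulus Q k) :
    Q < p := by
  by_contra! hle
  have h1 : p ∣ Q ! := Nat.dvd_factorial hp.pos hle
  have hd : k + 1 ∣ Q ! := Nat.dvd_factorial (by omega) hk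
  have h0 : 0 < Q ! / (k + 1) := Nat.div_pos (Nat.le_of_dvd (Nat.factorial_pos _) hd) (by omega)
  have h2 : 0 < Q ! * (Q ! / (k + 1)) := Nat.mul_pos (Nat.factorial_pos _) h0
  have h3 : modulus Q k + 1 = Q ! * (Q ! / (k + 1)) := by unfold modulus; omega
  have h4 : p ∣ modulus Q k + 1 := h3 ▸ h1.mul_right _
  exact hp.one_lt.ne' (Nat.dvd_one.1 ((Nat.dvd_add_right h).1 h4))

theorem modulus_ne_one {Q k : ℕ} (hQ : 3 ≤ Q) (hk : k + 1 ≤ Q) : modulus Q k ≠ 1 := by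
  intro h
  have h3 := modulus_spec hk
  rw [h] at h3
  have h4 : Q ≤ Q ! := Nat.self_le_factorial Q
  nlinarith

theorem modulus_coprime {Q k l : ℕ} (hk : k + 1 ≤ Q) (hl : l + 1 ≤ Q) (hkl : k ≠ l) :
    Nat.Coprime (modulus Q k) (modulus Q l) := by
  refine Nat.Coprime.symm (Nat.coprime_of_dvd fun p hp h1 h2 => ?_)
  have h3 := modulus_modEq hk h2
  have h4 := modulus_modEq hl h1
  have h5 : k ≡ l [MOD p] := h3.symm.trans h4
  have := modulus_prime hk hp h2
  exact hkl (Nat.ModEq.eq_of_lt_of_lt h5 (by omega) (by omega))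

theorem prod_modulus {Q y : ℕ} (hy : y ≤ Q) :
    ((Q ! * Q !) - 1).choose y = ∏ k ∈ Finset.range y, modulus Q k := by
  refine Nat.eq_of_mul_eq_mul_left (Nat.factorial_pos y) ?_
  rw [← Nat.descFactorial_eq_factorial_mul_choose, Nat.descFactorial_eq_prod_range,
    ← Finset.prod_range_add_one_eq_factorial y, ← Finset.prod_mul_distrib]
  refine Finset.prod_congr rfl fun k hk => ?_
  rw [modulus_sub]
  have := Finset.mem_range.1 hk
  omega

theorem modEq_of_dvd_choose {p a u : ℕ} (hp : p.Prime) (h : p ∣ a.choose (u + 1)) :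
    ∃ i ≤ u, a ≡ i [MOD p] := by
  by_cases ha : a ≤ u
  · exact ⟨a, ha, rfl⟩
  have h1 : p ∣ a.descFactorial (u + 1) := by
    rw [Nat.descFactorial_eq_factorial_mul_choose]; exact h.mul_left _
  rw [Nat.descFactorial_eq_prod_range, hp.prime.dvd_finsetProd_iff] at h1
  obtain ⟨i, hi, hd⟩ := h1
  have hi := Finset.mem_range.1 hi
  exact ⟨i, by omega, ((Nat.modEq_iff_dvd' (by omega)).2 hd).symm⟩

theorem modulus_dvd_choose {Q k a u i : ℕ} (hk : k + 1 ≤ Q) (hu : u + 1 ≤ Q) (hi : i ≤ u)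
    (h : a ≡ i [MOD modulus Q k]) : modulus Q k ∣ a.choose (u + 1) := by
  by_cases ha : a ≤ u
  · rw [Nat.choose_eq_zero_of_lt (by omega)]; exact dvd_zero _
  have hc : Nat.Coprime (modulus Q k) (u + 1)! := by
    refine Nat.coprime_of_dvd fun p hp h1 h2 => ?_
    have := modulus_prime hk hp h1
    have := (hp.dvd_factorial).1 h2
    omega
  refine hc.dvd_of_dvd_mul_left ?_
  rw [← Nat.descFactorial_eq_factorial_mul_choose, Nat.descFactorial_eq_prod_range]
  refine dvd_trans ?_ (Finset.dvd_prod_of_mem _ (Finset.mem_range.2 (show i < u + 1 by omega)))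
  exact (Nat.modEq_iff_dvd' (by omega)).1 h.symm

theorem bforall_iff {m n : ℕ} (p : Poly (Option (Fin m) ⊕ Fin n)) (C d : ℕ)
    (hC : ∀ (v : Option (Fin m) ⊕ Fin n → ℕ) (w : ℕ), (∀ i, v i ≤ w) →
      (p v).natAbs ≤ C * (w + 1) ^ d) (y : ℕ) (v : Fin m → ℕ) :
    (∀ k < y, ∃ t, p (Sum.elim (Option.elim' k v) t) = 0) ↔
    ∃ (a : Option (Fin n) → ℕ) , y ≤ a none ∧ (∀ i, v i ≤ a none) ∧
      (((((a none + 3 + C * (a none + 1) ^ d)! * (a none + 3 + C * (a none + 1) ^ d)!) - 1).choose y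
        ∣ (p (Sum.elim (Option.elim' (((a none + 3 + C * (a none + 1) ^ d)! *
          (a none + 3 + C * (a none + 1) ^ d)!) - 1) v) (a ∘ some))).natAbs) ∧
      ∀ j : Fin n, (((a none + 3 + C * (a none + 1) ^ d)! *
        (a none + 3 + C * (a none + 1) ^ d)!) - 1).choose y ∣
          (a (some j)).choose (a none + 1)) := by
  constructor
  · intro h
    choose! t ht using h
    obtain ⟨u, hyu, hvu, htu⟩ : ∃ u, y ≤ u ∧ (∀ i, v i ≤ u) ∧ ∀ k < y, ∀ j, t k j ≤ u := by
      refine ⟨y + ∑ i, v i + ∑ k ∈ Finset.range y, ∑ j, t k j, by omega, fun i => ?_,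
        fun k hk j => ?_⟩
      · have := Finset.single_le_sum (f := v) (fun _ _ => Nat.zero_le _) (Finset.mem_univ i)
        omega
      · have h1 := Finset.single_le_sum (f := t k) (fun _ _ => Nat.zero_le _) (Finset.mem_univ j)
        have h2 := Finset.single_le_sum (f := fun k => ∑ j, t k j) (fun _ _ => Nat.zero_le _)
          (Finset.mem_range.2 hk)
        omega
    set Q := u + 3 + C * (u + 1) ^ d with hQ
    have hy : y ≤ Q := by omega
    have hco : Set.Pairwise ↑(Finset.range y) (Function.onFun Nat.Coprime (modulus Q)) := by
      intro k hk l hl hkl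
      have hk := Finset.mem_range.1 hk
      have hl := Finset.mem_range.1 hl
      exact modulus_coprime (by omega) (by omega) hkl
    have hne : ∀ k ∈ Finset.range y, modulus Q k ≠ 0 := by
      intro k hk h0
      have hk := Finset.mem_range.1 hk
      have := modulus_prime (Q := Q) (k := k) (by omega) Nat.prime_two (by rw [h0]; exact dvd_zero _)
      omega
    have hcrt : ∀ j, ∃ a, ∀ k ∈ Finset.range y, a ≡ t k j [MOD modulus Q k] := fun j =>
      ⟨_, (Nat.chineseRemainderOfFinset (fun k => t k j) (modulus Q) (Finset.range y) hne hco).2⟩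
    choose a ha using hcrt
    refine ⟨Option.elim' u a, hyu, hvu, ?_⟩
    simp only [Option.elim'_none, Option.elim'_some, ← hQ]
    rw [prod_modulus hy]
    have hprod : ∀ N : ℕ, (∀ k < y, modulus Q k ∣ N) → ∏ k ∈ Finset.range y, modulus Q k ∣ N := by
      intro N hN
      refine Finset.prod_dvd_of_isRelPrime (fun k hk l hl hkl => ?_) fun k hk => hN k (Finset.mem_range.1 hk)
      exact Nat.coprime_iff_isRelPrime.1 (hco hk hl hkl)
    refine ⟨hprod _ fun k hk => ?_, fun j => hprod _ fun k hk => ?_⟩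
    · have := isPoly_congr p.isPoly (modulus Q k)
        (Sum.elim (Option.elim' ((Q ! * Q !) - 1) v) (Option.elim' u a ∘ some))
        (Sum.elim (Option.elim' k v) (t k)) (by
          rintro ((_ | i) | j)
          · exact modulus_modEq (k := k) (by omega) dvd_rfl
          · rfl
          · exact ha j k (Finset.mem_range.2 hk))
      rw [ht k hk] at this
      exact Int.natCast_dvd.1 (Int.modEq_zero_iff_dvd.1 this)
    · exact modulus_dvd_choose (by omega) (by omega) (htu k hk j) (ha j k (Finset.mem_range.2 hk))
  · rintro ⟨a, hy, hv, h1, h2⟩ k hk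
    set u := a none with hu
    set Q := u + 3 + C * (u + 1) ^ d with hQ
    obtain ⟨q, hq, hqd⟩ := Nat.exists_prime_and_dvd
      (modulus_ne_one (Q := Q) (k := k) (by omega) (by omega))
    have hqQ := modulus_prime (by omega) hq hqd
    have hM : q ∣ ((Q ! * Q !) - 1).choose y := by
      rw [prod_modulus (by omega)]
      exact hqd.trans (Finset.dvd_prod_of_mem _ (Finset.mem_range.2 hk))
    choose t htu ht using fun j => modEq_of_dvd_choose hq (hM.trans (h2 j))
    refine ⟨t, ?_⟩
    have := isPoly_congr p.isPoly q
        (Sum.elim (Option.elim' ((Q ! * Q !) - 1) v) (a ∘ some))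
        (Sum.elim (Option.elim' k v) t) (by
          rintro ((_ | i) | j)
          · exact modulus_modEq (k := k) (by omega) hqd
          · rfl
          · exact ht j)
    have h3 := this.symm.trans (Int.modEq_zero_iff_dvd.2 (Int.natCast_dvd.2 (hM.trans h1)))
    have h4 := Int.natCast_dvd.1 (Int.modEq_zero_iff_dvd.1 h3)
    have h5 := hC (Sum.elim (Option.elim' k v) t) u (by
          rintro ((_ | i) | j)
          · exact (show k ≤ u by omega)
          · exact hv i
          · exact htu j)
    exact Int.natAbs_eq_zero.1 (Nat.eq_zero_of_dvd_of_lt h4 (lt_of_le_of_lt h5 (by omega)))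

theorem comp1_diophFn {α : Type} {g : (Option α → ℕ) → ℕ} (dg : DiophFn g)
    {c : (α → ℕ) → ℕ} (dc : DiophFn c) : DiophFn fun w => g (Option.elim' (c w) w) := by
  have h1 := reindex_dioph (Option (Option α))
    (Option.elim' (some none) (Option.elim' none (some ∘ some))) dg
  have h2 := diophFn_comp1 h1 (reindex_diophFn (some : α → Option α) dc)
  refine Dioph.ext h2 fun x => ?_
  have : (Option.elim' (c (x ∘ some)) x ∘
      Option.elim' (some none) (Option.elim' none (some ∘ some))) ∘ some =
      Option.elim' (c (x ∘ some)) (x ∘ some) := by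
    funext i; rcases i with _ | i <;> rfl
  change g ((Option.elim' (c (x ∘ some)) x ∘
      Option.elim' (some none) (Option.elim' none (some ∘ some))) ∘ some) = x none ↔ _
  rw [this]
  rfl

theorem bforall_dioph {m : ℕ} {S : Set (Option (Fin m) → ℕ)} (h : Dioph S)
    {f : (Fin m → ℕ) → ℕ} (df : DiophFn f) :
    Dioph {v : Fin m → ℕ | ∀ k < f v, Option.elim' k v ∈ S} := by
  obtain ⟨n, p, hp⟩ := dioph_finite h
  obtain ⟨C, d, hC⟩ := isPoly_bound p.isPoly
  have key := fun v : Fin m → ℕ => bforall_iff p C d hC (f v) v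
  refine Dioph.ext (S := {v : Fin m → ℕ | ∃ a : Option (Fin n) → ℕ, Sum.elim v a ∈
    {w : Fin m ⊕ Option (Fin n) → ℕ |
      f (w ∘ inl) ≤ w (inr none) ∧ (∀ i : Fin m, w ∈ {w | w (inl i) ≤ w (inr none)}) ∧
      ((((w (inr none) + 3 + C * (w (inr none) + 1) ^ d)! *
          (w (inr none) + 3 + C * (w (inr none) + 1) ^ d)!) - 1).choose (f (w ∘ inl))
        ∣ (p (Sum.elim (Option.elim' (((w (inr none) + 3 + C * (w (inr none) + 1) ^ d)! *
          (w (inr none) + 3 + C * (w (inr none) + 1) ^ d)!) - 1) (w ∘ inl))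
            (w ∘ inr ∘ some))).natAbs) ∧
      ∀ j : Fin n, w ∈ {w : Fin m ⊕ Option (Fin n) → ℕ |
          (((w (inr none) + 3 + C * (w (inr none) + 1) ^ d)! *
          (w (inr none) + 3 + C * (w (inr none) + 1) ^ d)!) - 1).choose (f (w ∘ inl)) ∣
          (w (inr (some j))).choose (w (inr none) + 1)}}}) (ex_dioph ?_) fun v => ?_
  · have du : DiophFn fun w : Fin m ⊕ Option (Fin n) → ℕ => w (inr none) := proj_dioph _
    have dQ : DiophFn fun w : Fin m ⊕ Option (Fin n) → ℕ =>
        (w (inr none) + 3 + C * (w (inr none) + 1) ^ d)! :=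
      factorial_dioph (add_dioph (add_dioph du (const_dioph 3)) (mul_dioph (const_dioph C)
        (pow_dioph (add_dioph du (const_dioph 1)) (const_dioph d))))
    have dc := sub_dioph (mul_dioph dQ dQ) (const_dioph 1)
    have df' := reindex_diophFn (inl : Fin m → Fin m ⊕ Option (Fin n)) df
    have dM := choose_dioph dc df'
    refine (le_dioph df' du).inter ((forall_dioph fun i => le_dioph (proj_dioph _) du).inter
      ((dvd_dioph dM ?_).inter
        (forall_dioph fun j => dvd_dioph dM (choose_dioph (proj_dioph _)
          (add_dioph du (const_dioph 1))))))
    have := abs_poly_dioph p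
    have h2 := reindex_diophFn (β := Option (Fin m ⊕ Option (Fin n)))
      (Sum.elim (Option.elim' none (some ∘ inl)) (some ∘ inr ∘ some)) this
    convert! comp1_diophFn h2 dc using 4 with w
    funext i
    rcases i with (_ | i) | j <;> rfl
  · refine Iff.trans ?_ ((key v).symm.trans ?_)
    · rfl
    · exact forall₂_congr fun k _ => (hp _).symm

open Vector3
open scoped Vector3

theorem bforall_vec {m : ℕ} {S : Set (Vector3 ℕ (succ m))} (h : Dioph S)
    {f : Vector3 ℕ m → ℕ} (df : DiophFn f) :
    Dioph {v : Vector3 ℕ m | ∀ k < f v, (k :: v) ∈ S} := by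
  let e : Fin2 m ≃ Fin (Fintype.card (Fin2 m)) := Fintype.equivFin _
  have h1 := reindex_dioph (Option (Fin (Fintype.card (Fin2 m)))) (none :: (some ∘ e)) h
  have h2 := reindex_dioph (Fin2 m) e.symm (bforall_dioph h1 (reindex_diophFn e df))
  refine Dioph.ext h2 fun v => ?_
  have e1 : (v ∘ e.symm) ∘ e = v := by funext i; simp
  have e2 : ∀ k, Option.elim' k (v ∘ e.symm) ∘ (none :: (some ∘ e)) = (k :: v) := by
    intro k
    funext i
    cases i with
    | fz => rfl
    | fs i => change v (e.symm (e i)) = v i; simp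
  simp only [Set.mem_ofPred_eq, e1, e2]
  rfl

/-! ### Partial recursive functions have Diophantine graphs -/

theorem pair_dioph {α : Type} {f g : (α → ℕ) → ℕ} (df : DiophFn f) (dg : DiophFn g) :
    DiophFn fun v => Nat.pair (f v) (g v) := by
  refine diophFn_comp2 df dg ((diophFn_vec _).2 ?_)
  have : Dioph {v : Vector3 ℕ 3 | (v &1 < v &2 ∧ v &2 * v &2 + v &1 = v &0) ∨
      (v &2 ≤ v &1 ∧ v &1 * v &1 + v &1 + v &2 = v &0)} :=
    (D&1 D< D&2 D∧ D&2 D* D&2 D+ D&1 D= D&0) D∨ (D&2 D≤ D&1 D∧ D&1 D* D&1 D+ D&1 D+ D&2 D= D&0)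
  refine Dioph.ext this <| (vectorAll_iff_forall _).1 fun z x y => ?_
  change ((x < y ∧ y * y + x = z) ∨ (y ≤ x ∧ x * x + x + y = z)) ↔ Nat.pair x y = z
  unfold Nat.pair
  split_ifs <;> omega

/-- The graph of a partial function on `ℕ` is Diophantine. -/
def DGraph (f : ℕ →. ℕ) : Prop := Dioph {v : Vector3 ℕ 2 | v &1 ∈ f (v &0)}

theorem DGraph.comp {f : ℕ →. ℕ} (h : DGraph f) {α : Type} {g k : (α → ℕ) → ℕ}
    (dg : DiophFn g) (dk : DiophFn k) : Dioph {v | k v ∈ f (g v)} :=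
  dioph_comp2 (S := fun x y => y ∈ f x) dg dk h

theorem mem_prec {f g : ℕ →. ℕ} {a n z : ℕ} :
    (z ∈ (n.rec (f a) fun y IH => IH.bind fun i => g (Nat.pair a (Nat.pair y i)) : Part ℕ)) ↔
    ∃ s t, s % ((0 + 1) * t + 1) ∈ f a ∧
      (∀ k < n, s % ((k + 2) * t + 1) ∈ g (Nat.pair a (Nat.pair k (s % ((k + 1) * t + 1))))) ∧
      s % ((n + 1) * t + 1) = z := by
  constructor
  · intro h
    have : ∃ l : ℕ → ℕ, l 0 ∈ f a ∧ (∀ k < n, l (k + 1) ∈ g (Nat.pair a (Nat.pair k (l k)))) ∧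
        l n = z := by
      induction n generalizing z with
      | zero => exact ⟨fun _ => z, h, by simp, rfl⟩
      | succ n ih =>
        obtain ⟨i, hi, hz⟩ := Part.mem_bind_iff.1 h
        obtain ⟨l, h0, h1, h2⟩ := ih hi
        refine ⟨fun k => if k ≤ n then l k else z, by simpa using h0, fun k hk => ?_, by simp⟩
        by_cases hkn : k = n
        · subst hkn
          simpa [h2] using hz
        · have : k < n := by omega
          simpa [this.le, show k + 1 ≤ n by omega] using h1 k this
    obtain ⟨l, h0, h1, h2⟩ := this
    let L := List.ofFn fun i : Fin (n + 1) => l i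
    have hb : ∀ k ≤ n, Nat.beta (Nat.unbeta L) k = l k := by
      intro k hk
      have := Nat.beta_unbeta_coe L ⟨k, by simp [L]; omega⟩
      refine this.trans ?_
      simp only [L, Fin.getElem_fin, List.getElem_ofFn]
    unfold Nat.beta at hb
    refine ⟨(Nat.unbeta L).unpair.1, (Nat.unbeta L).unpair.2, ?_, fun k hk => ?_, ?_⟩
    · rw [hb 0 (by omega)]; exact h0
    · rw [hb k (by omega), hb (k + 1) (by omega)]; exact h1 k hk
    · rw [hb n le_rfl]; exact h2
  · rintro ⟨s, t, h0, h1, h2⟩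
    induction n generalizing z with
    | zero => subst h2; exact h0
    | succ n ih =>
      refine Part.mem_bind_iff.2 ⟨_, ih (fun k hk => h1 k (by omega)) rfl, ?_⟩
      rw [← h2]
      exact h1 n (by omega)

theorem partrec_dioph {f : ℕ →. ℕ} (hf : Nat.Partrec f) : DGraph f := by
  induction hf with
  | zero =>
    refine Dioph.ext (D&1 D= D.0) fun v => ?_
    exact (Part.mem_some_iff).symm
  | succ =>
    refine Dioph.ext (D&1 D= D&0 D+ D.1) fun v => ?_
    exact (Part.mem_some_iff).symm
  | left =>
    have : Dioph {v : Vector3 ℕ 2 | ∃ b, Nat.pair (v &1) b = v &0} :=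
      (D∃) 2 <| pair_dioph (D&2) (D&0) D= D&1
    refine Dioph.ext this fun v => ?_
    refine Iff.trans ?_ (Part.mem_some_iff).symm
    constructor
    · rintro ⟨b, hb⟩
      rw [← hb]; simp
    · intro h
      refine ⟨(v &0).unpair.2, ?_⟩
      rw [h]; simp
  | right =>
    have : Dioph {v : Vector3 ℕ 2 | ∃ b, Nat.pair b (v &1) = v &0} :=
      (D∃) 2 <| pair_dioph (D&0) (D&2) D= D&1
    refine Dioph.ext this fun v => ?_
    refine Iff.trans ?_ (Part.mem_some_iff).symm
    constructor
    · rintro ⟨b, hb⟩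
      rw [← hb]; simp
    · intro h
      refine ⟨(v &0).unpair.1, ?_⟩
      rw [h]; simp
  | @pair f g _ _ hf hg =>
    have : Dioph {v : Vector3 ℕ 2 | ∃ a b, (a ∈ f (v &0) ∧ b ∈ g (v &0)) ∧ Nat.pair a b = v &1} :=
      (D∃) 2 <| (D∃) 3 <| (hf.comp (D&2) (D&1) D∧ hg.comp (D&2) (D&0)) D∧
        (pair_dioph (D&1) (D&0) D= D&3)
    refine Dioph.ext this fun v => ?_
    simp [Seq.seq, and_assoc]
  | @comp f g _ _ hf hg =>
    have : Dioph {v : Vector3 ℕ 2 | ∃ b, b ∈ g (v &0) ∧ v &1 ∈ f b} :=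
      (D∃) 2 <| hg.comp (D&1) (D&0) D∧ hf.comp (D&0) (D&2)
    refine Dioph.ext this fun v => ?_
    exact (Part.mem_bind_iff).symm
  | @prec f g _ _ hf hg =>
    have hb : Dioph {v : Vector3 ℕ 6 | ∀ k < v &2, (k :: v) ∈ {v : Vector3 ℕ 7 |
        v &2 % ((v &0 + 2) * v &1 + 1) ∈
          g (Nat.pair (v &4) (Nat.pair (v &0) (v &2 % ((v &0 + 1) * v &1 + 1))))}} :=
      bforall_vec (hg.comp
        (pair_dioph (D&4) (pair_dioph (D&0) (D&2 D% ((D&0 D+ D.1) D* D&1 D+ D.1))))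
        (D&2 D% ((D&0 D+ D.2) D* D&1 D+ D.1))) (D&2)
    have : Dioph {v : Vector3 ℕ 2 | ∃ a n s t, Nat.pair a n = v &0 ∧
        s % ((0 + 1) * t + 1) ∈ f a ∧
      (∀ k < n, s % ((k + 2) * t + 1) ∈ g (Nat.pair a (Nat.pair k (s % ((k + 1) * t + 1))))) ∧
      s % ((n + 1) * t + 1) = v &1} :=
      (D∃) 2 <| (D∃) 3 <| (D∃) 4 <| (D∃) 5 <| (pair_dioph (D&3) (D&2) D= D&4) D∧
        hf.comp (D&3) (D&1 D% ((D.0 D+ D.1) D* D&0 D+ D.1)) D∧ hb D∧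
        (D&1 D% ((D&2 D+ D.1) D* D&0 D+ D.1) D= D&5)
    refine Dioph.ext this fun v => ?_
    refine Iff.trans ?_ (mem_prec (f := f) (g := g) (a := (v &0).unpair.1)
      (n := (v &0).unpair.2)).symm
    constructor
    · rintro ⟨a, n, s, t, h, H⟩
      rw [← h]
      simp only [Nat.unpair_pair]
      exact ⟨s, t, H⟩
    · rintro ⟨s, t, H⟩
      exact ⟨_, _, s, t, Nat.pair_unpair _, H⟩
  | @rfind f _ hf =>
    have hb : Dioph {v : Vector3 ℕ 2 | ∀ k < v &1, (k :: v) ∈ {v : Vector3 ℕ 3 |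
        ∃ j, j + 1 ∈ f (Nat.pair (v &1) (v &0))}} :=
      bforall_vec ((D∃) 3 <| hf.comp (pair_dioph (D&2) (D&1)) (D&0 D+ D.1)) (D&1)
    have : Dioph {v : Vector3 ℕ 2 | 0 ∈ f (Nat.pair (v &0) (v &1)) ∧
        ∀ k < v &1, ∃ j, j + 1 ∈ f (Nat.pair (v &0) k)} :=
      hf.comp (pair_dioph (D&0) (D&1)) (D.0) D∧ hb
    refine Dioph.ext this fun v => ?_
    refine Iff.trans ?_ (Nat.mem_rfind).symm
    refine and_congr ?_ (forall_congr' fun k => imp_congr Iff.rfl ?_)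
    · simp
    · simp
      constructor
      · rintro ⟨j, hj⟩; exact ⟨_, hj, by omega⟩
      · rintro ⟨j, hj, h0⟩
        exact ⟨j - 1, by rwa [Nat.sub_add_cancel (by omega)]⟩

theorem isDiophantine_of_dioph {P : ℕ → Prop} (h : Dioph {v : Fin 1 → ℕ | P (v 0)}) :
    ∃ (n : ℕ) (p : MvPolynomial (Fin (n + 1)) ℤ),
    ∀ a : ℕ, P a ↔ ∃ x : Fin n → ℕ,
      MvPolynomial.eval (Fin.cons (a : ℤ) (fun i => ((x i : ℕ) : ℤ))) p = 0 := by
  obtain ⟨n, p, hp⟩ := dioph_finite h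
  obtain ⟨q, hq⟩ := isPoly_mv p.isPoly
  refine ⟨n, MvPolynomial.rename (Sum.elim (fun _ => 0) Fin.succ) q, fun a => ?_⟩
  refine (hp (fun _ => a)).trans (exists_congr fun x => ?_)
  rw [← hq, MvPolynomial.eval_rename]
  have : (fun i => ((Sum.elim (fun _ : Fin 1 => a) x i : ℕ) : ℤ)) =
    (Fin.cons (a : ℤ) (fun i => ((x i : ℕ) : ℤ)) : Fin (n + 1) → ℤ) ∘
      (Sum.elim (fun _ => 0) Fin.succ) := by
    funext i
    rcases i with i | i <;> simp
  rw [this]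

end MRDP

/-- If `S` is a computable set of naturals, then both `S` and its complement
are Diophantine. -/
theorem computable_set_and_complement_diophantine (S : Set ℕ)
    (hS : ComputablePred (· ∈ S)) :
    IsDiophantine S ∧ IsDiophantine Sᶜ := by
  classical
  obtain ⟨inst, hc⟩ := hS
  have h1 : Computable fun a : ℕ => Encodable.encode (decide (a ∈ S)) := Computable.encode.comp hc
  have h2 : Nat.Partrec (fun a : ℕ => Part.some (Encodable.encode (decide (a ∈ S)))) :=
    Partrec.nat_iff.1 h1
  have h3 := MRDP.partrec_dioph h2
  have h4 : ∀ b : ℕ, Dioph {v : Fin 1 → ℕ | b = Encodable.encode (decide (v 0 ∈ S))} := by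
    intro b
    refine Dioph.ext (h3.comp (Dioph.proj_dioph (0 : Fin 1)) (Dioph.const_dioph b)) fun v => ?_
    exact Part.mem_some_iff
  constructor
  · obtain ⟨n, p, h⟩ := MRDP.isDiophantine_of_dioph
      (P := fun a => 1 = Encodable.encode (decide (a ∈ S))) (h4 1)
    refine ⟨n, p, fun a => Iff.trans ?_ (h a)⟩
    by_cases ha : a ∈ S <;> simp [ha]
  · obtain ⟨n, p, h⟩ := MRDP.isDiophantine_of_dioph
      (P := fun a => 0 = Encodable.encode (decide (a ∈ S))) (h4 0)
    refine ⟨n, p, fun a => Iff.trans ?_ (h a)⟩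
    by_cases ha : a ∈ S <;> simp [ha]
end

section
/- Davis's 1972 theorem on numbers of solutions (parametric form): for every subset A of ℕ∞ = ℕ ∪ {∞} with A ≠ ∅ and A ≠ ℕ∞, there exist n ∈ ℕ and a polynomial p ∈ MvPolynomial (Fin (n+1)) ℤ such that the set {a : ℕ | Set.encard {x : Fin n → ℕ | p(a, x) = 0} ∈ A} is not computable. In particular, no algorithm can establish, for the members of this family of Diophantine equations, whether the number of distinct solutions in natural numbers belongs to A. -/
namespace DavisAux
theorem digit_sum (u : ℕ) (hu : 0 < u) (k : ℕ) : ∀ (n : ℕ) (a : ℕ → ℕ), (∀ i, a i < u) →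
    (∑ i ∈ Finset.range n, a i * u ^ i) / u ^ k % u = if k < n then a k else 0 := by
  induction k with
  | zero =>
    intro n a ha
    cases n with
    | zero => simp
    | succ n =>
      rw [Finset.sum_range_succ']
      simp only [pow_succ, ← mul_assoc, ← Finset.sum_mul]
      simp [Nat.add_mod, Nat.mod_eq_of_lt (ha 0)]
  | succ k ih =>
    intro n a ha
    cases n with
    | zero => simp
    | succ n =>
      rw [Finset.sum_range_succ']
      simp only [pow_succ, ← mul_assoc, ← Finset.sum_mul]
      have h := ih n (fun i => a (i + 1)) (fun i => ha (i + 1))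
      rw [mul_comm (u ^ k) u, ← Nat.div_div_eq_div_mul]
      have e : ((∑ i ∈ Finset.range n, a (i + 1) * u ^ i) * u + a 0 * u ^ 0) / u
          = ∑ i ∈ Finset.range n, a (i + 1) * u ^ i := by
        rw [pow_zero, mul_one, Nat.add_comm, Nat.add_mul_div_right _ _ hu,
          Nat.div_eq_of_lt (ha 0), zero_add]
      rw [e, h]
      simp

theorem choose_eq (n k : ℕ) :
    n.choose k = ((2 ^ n + 1 + 1) ^ n / (2 ^ n + 1) ^ k) % (2 ^ n + 1) := by
  rw [add_pow (2 ^ n + 1) 1 n]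
  simp only [one_pow, mul_one]
  have h := digit_sum (2 ^ n + 1) (by positivity) k (n + 1) (fun i => n.choose i)
    (fun i => Nat.lt_succ_of_le (Nat.choose_le_two_pow n i))
  simp only [mul_comm] at h ⊢
  simp only [Nat.cast_id]
  rw [h]
  split_ifs with hk
  · rfl
  · exact Nat.choose_eq_zero_of_lt (by omega)

theorem factorial_eq (n : ℕ) :
    n.factorial = ((n + 1) ^ 2 * (n ^ n + 1)) ^ n / ((n + 1) ^ 2 * (n ^ n + 1)).choose n := by
  set r := (n + 1) ^ 2 * (n ^ n + 1) with hr
  have hf : n.factorial ≤ n ^ n := Nat.factorial_le_pow n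
  have hrn : n ^ 2 * (n.factorial + 1) + n < r := by
    have : (n + 1) ^ 2 * (n.factorial + 1) ≤ r := Nat.mul_le_mul_left _ (by omega)
    have h1 := n.factorial_pos
    nlinarith
  have hnr : n ≤ r := by
    have := Nat.zero_le (n ^ 2 * (n.factorial + 1)); omega
  have hc : 0 < r.choose n := Nat.choose_pos hnr
  have hd := Nat.descFactorial_eq_factorial_mul_choose r n
  symm
  apply Nat.div_eq_of_lt_le
  · rw [← hd]; exact Nat.descFactorial_le_pow r n
  · have hp := Nat.pow_sub_le_descFactorial r n
    have key : n.factorial * r ^ n < (n.factorial + 1) * (r + 1 - n) ^ n := by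
      have hr0 : (0 : ℝ) < r := by
        have : 0 < r := by omega
        exact_mod_cast this
      have hnr' : (n : ℝ) ≤ r := by exact_mod_cast hnr
      have hb := one_add_mul_le_pow (a := -((n : ℝ) / r)) (by
        have : (n : ℝ) / r ≤ 1 := (div_le_one hr0).2 hnr'
        linarith) n
      have hb2 : (1 - (n : ℝ) ^ 2 / r) * r ^ n ≤ ((r : ℝ) + 1 - n) ^ n := by
        calc (1 - (n : ℝ) ^ 2 / r) * r ^ n = (1 + n * -((n : ℝ) / r)) * r ^ n := by ring
          _ ≤ (1 + -((n : ℝ) / r)) ^ n * r ^ n := by gcongr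
          _ = ((1 + -((n : ℝ) / r)) * r) ^ n := by rw [mul_pow]
          _ = ((r : ℝ) - n) ^ n := by congr 1; field_simp; ring
          _ ≤ _ := by
            apply pow_le_pow_left₀ <;> linarith
      have hlt : (n.factorial : ℝ) < (n.factorial + 1) * (1 - (n : ℝ) ^ 2 / r) := by
        have h3 : ((n : ℝ) ^ 2 * (n.factorial + 1)) < r := by
          have : n ^ 2 * (n.factorial + 1) < r := by omega
          exact_mod_cast this
        have h4 : ((n : ℝ) ^ 2 * (n.factorial + 1)) / r < 1 := (div_lt_one hr0).2 h3
        have h5 : ((n.factorial : ℝ) + 1) * (1 - (n : ℝ) ^ 2 / r)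
          = n.factorial + 1 - ((n : ℝ) ^ 2 * (n.factorial + 1)) / r := by ring
        rw [h5]; linarith
      have : (n.factorial : ℝ) * r ^ n < (n.factorial + 1) * ((r : ℝ) + 1 - n) ^ n := by
        calc (n.factorial : ℝ) * r ^ n
            < (n.factorial + 1) * (1 - (n : ℝ) ^ 2 / r) * r ^ n := by gcongr
          _ = (n.factorial + 1) * ((1 - (n : ℝ) ^ 2 / r) * r ^ n) := by ring
          _ ≤ _ := by gcongr
      have hcast : ((r + 1 - n : ℕ) : ℝ) = (r : ℝ) + 1 - n := by
        rw [Nat.cast_sub (by omega)]; push_cast; ring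
      rw [← hcast] at this
      exact_mod_cast this
    have h2 : n.factorial * r ^ n < n.factorial * ((n.factorial + 1) * r.choose n) := by
      calc _ < _ := key
        _ ≤ (n.factorial + 1) * r.descFactorial n := by gcongr
        _ = _ := by rw [hd]; ring
    exact Nat.lt_of_mul_lt_mul_left h2

section
open Dioph
variable {α : Type} {f g : (α → ℕ) → ℕ}
theorem choose_dioph (df : DiophFn f) (dg : DiophFn g) :
    DiophFn fun v => (f v).choose (g v) := by
  have h2 := add_dioph (pow_dioph (const_dioph (α := α) 2) df) (const_dioph 1)
  have h := mod_dioph (div_dioph (pow_dioph (add_dioph h2 (const_dioph 1)) df) (pow_dioph h2 dg)) h2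
  simp only [choose_eq]
  exact h

theorem factorial_dioph (df : DiophFn f) : DiophFn fun v => (f v).factorial := by
  have h1 := pow_dioph (add_dioph df (const_dioph 1)) (const_dioph 2)
  have h2 := mul_dioph h1 (add_dioph (pow_dioph df df) (const_dioph 1))
  have h3 := div_dioph (pow_dioph h2 df) (choose_dioph h2 df)
  simp only [factorial_eq]
  exact h3
end
end DavisAux
namespace DavisAux
/-- The moduli. -/
def qq (B k : ℕ) : ℕ := B.factorial ^ 2 / (k + 1) - 1

theorem fact_dvd {B k : ℕ} (hk : k < B) : B.factorial ∣ B.factorial ^ 2 / (k + 1) := by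
  obtain ⟨c, hc⟩ := Nat.dvd_factorial (Nat.succ_pos k) hk
  refine ⟨c, ?_⟩
  apply Nat.div_eq_of_eq_mul_right (Nat.succ_pos k)
  rw [pow_two]
  nth_rewrite 2 [hc]
  rw [Nat.succ_eq_add_one]; ring

theorem qq_spec {B k : ℕ} (hk : k < B) : B.factorial ^ 2 - 1 - k = (k + 1) * qq B k := by
  have h : (k + 1) ∣ B.factorial ^ 2 :=
    (Nat.dvd_factorial (Nat.succ_pos k) hk).trans (dvd_pow_self _ two_ne_zero)
  rw [qq, Nat.mul_sub, Nat.mul_div_cancel' h]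
  omega

theorem fact_le {B k : ℕ} (hk : k < B) : B.factorial ≤ B.factorial ^ 2 / (k + 1) := by
  apply Nat.le_of_dvd _ (fact_dvd hk)
  apply Nat.div_pos _ (Nat.succ_pos k)
  exact (Nat.succ_le_of_lt hk).trans ((Nat.self_le_factorial B).trans
    (Nat.le_self_pow two_ne_zero _))

theorem qq_gt {B k : ℕ} (hB : 3 ≤ B) (hk : k < B) : 2 ≤ qq B k := by
  have := fact_le hk
  have := Nat.self_le_factorial B
  unfold qq; omega

theorem lt_prime {B k p : ℕ} (hk : k < B) (hp : p.Prime) (h : p ∣ qq B k) : B < p := by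
  by_contra hlt
  have h1 : p ∣ B.factorial ^ 2 / (k + 1) :=
    (Nat.dvd_factorial hp.pos (by omega)).trans (fact_dvd hk)
  have h2 := Nat.dvd_sub h1 h
  have h3 := fact_le hk
  have h4 := B.factorial_pos
  have : B.factorial ^ 2 / (k + 1) - qq B k = 1 := by unfold qq; omega
  rw [this] at h2
  exact hp.one_lt.ne' (Nat.dvd_one.1 h2)

theorem sub_modEq {B k m : ℕ} (hk : k < B) (h : m ∣ qq B k) :
    k ≡ B.factorial ^ 2 - 1 [MOD m] := by
  have h1 := qq_spec hk
  have h2 := fact_le hk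
  have h3 : k ≤ B.factorial ^ 2 - 1 := by
    have := (Nat.self_le_factorial B).trans (Nat.le_self_pow two_ne_zero B.factorial)
    omega
  rw [Nat.modEq_iff_dvd' h3, h1]
  exact Dvd.dvd.mul_left h _

theorem qq_coprime {B j k : ℕ} (hj : j < B) (hk : k < B) (hne : j ≠ k) :
    Nat.Coprime (qq B j) (qq B k) := by
  apply Nat.coprime_of_dvd
  intro p hp h1 h2
  have hB := lt_prime hj hp h1
  have := (sub_modEq hj h1).trans (sub_modEq hk h2).symm
  exact hne (Nat.ModEq.eq_of_lt_of_lt this (by omega) (by omega))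

theorem choose_qq {B y : ℕ} (hy : y ≤ B) :
    (B.factorial ^ 2 - 1).choose y = ∏ k ∈ Finset.range y, qq B k := by
  have h := Nat.descFactorial_eq_factorial_mul_choose (B.factorial ^ 2 - 1) y
  rw [Nat.descFactorial_eq_prod_range] at h
  rw [Finset.prod_congr rfl (fun k hk => qq_spec (B := B) (k := k)
    (lt_of_lt_of_le (Finset.mem_range.1 hk) hy)), Finset.prod_mul_distrib,
    Finset.prod_range_add_one_eq_factorial] at h
  exact (Nat.eq_of_mul_eq_mul_left (Nat.factorial_pos y) h).symm

theorem exists_residue {p X u : ℕ} (hp : p.Prime) (h : p ∣ X.choose u) :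
    ∃ j < u, j ≡ X [MOD p] := by
  by_cases hX : X < u
  · exact ⟨X, hX, rfl⟩
  · have h1 : p ∣ X.descFactorial u := by
      rw [Nat.descFactorial_eq_factorial_mul_choose]; exact Dvd.dvd.mul_left h _
    rw [Nat.descFactorial_eq_prod_range, Prime.dvd_finsetProd_iff hp.prime] at h1
    obtain ⟨j, hj, hd⟩ := h1
    have hj := Finset.mem_range.1 hj
    exact ⟨j, hj, (Nat.modEq_iff_dvd' (by omega)).2 hd⟩

theorem bounded_core {m : ℕ} (f g : ℕ → (Fin m → ℕ) → ℕ)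
    (fm : ∀ k k' x x', k ≤ k' → x ≤ x' → f k x ≤ f k' x')
    (gm : ∀ k k' x x', k ≤ k' → x ≤ x' → g k x ≤ g k' x')
    (fc : ∀ n k k' x x', k ≡ k' [MOD n] → (∀ i, x i ≡ x' i [MOD n]) → f k x ≡ f k' x' [MOD n])
    (gc : ∀ n k k' x x', k ≡ k' [MOD n] → (∀ i, x i ≡ x' i [MOD n]) → g k x ≡ g k' x' [MOD n])
    (y : ℕ) :
    (∀ k < y, ∃ x, f k x = g k x) ↔
      ∃ B u, (y + u + f y (fun _ => u) + g y (fun _ => u) + 3 = B) ∧ ∃ X : Fin m → ℕ,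
        (∀ i, (B.factorial ^ 2 - 1).choose y ∣ (X i).choose u) ∧
        f (B.factorial ^ 2 - 1) X ≡ g (B.factorial ^ 2 - 1) X
          [MOD (B.factorial ^ 2 - 1).choose y] := by
  constructor
  · intro h
    have h' : ∀ k : ℕ, ∃ x, k < y → f k x = g k x := by
      intro k
      by_cases hk : k < y
      · obtain ⟨x, hx⟩ := h k hk; exact ⟨x, fun _ => hx⟩
      · exact ⟨fun _ => 0, fun hh => absurd hh hk⟩
    choose x hx using h'
    set u := (Finset.range y).sup (fun k => Finset.univ.sup (x k)) + 1 with hu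
    have hxu : ∀ k < y, ∀ i, x k i < u := by
      intro k hk i
      have h1 : x k i ≤ Finset.univ.sup (x k) := Finset.le_sup (Finset.mem_univ i)
      have h2 := Finset.le_sup (f := fun k => Finset.univ.sup (x k)) (Finset.mem_range.2 hk)
      omega
    obtain ⟨B, hB⟩ : ∃ B, y + u + f y (fun _ => u) + g y (fun _ => u) + 3 = B := ⟨_, rfl⟩
    have hyB : y ≤ B := by omega
    have huB : u ≤ B := by omega
    have cop : Set.Pairwise (Finset.range y : Set ℕ) (Function.onFun Nat.Coprime (qq B)) := by
      intro j hj k hk hne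
      have hj := Finset.mem_range.1 hj
      have hk := Finset.mem_range.1 hk
      exact qq_coprime (by omega) (by omega) hne
    have crt : ∀ i, ∃ X, ∀ k ∈ Finset.range y, X ≡ x k i [MOD qq B k] := fun i =>
      let r := Nat.chineseRemainderOfFinset (fun k => x k i) (qq B) (Finset.range y)
        (by
          intro k hk
          have hk := Finset.mem_range.1 hk
          have := qq_gt (B := B) (k := k) (by omega) (by omega)
          omega) cop
      ⟨r.1, r.2⟩
    choose X hX using crt
    refine ⟨B, u, hB, X, ?_, ?_⟩
    · intro i
      rw [choose_qq hyB]
      apply Finset.prod_dvd_of_isRelPrime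
      · intro j hj k hk hne
        exact Nat.coprime_iff_isRelPrime.1 (cop hj hk hne)
      · intro k hk
        have hk' := Finset.mem_range.1 hk
        have c1 : Nat.Coprime (qq B k) u.factorial := by
          apply Nat.coprime_of_dvd
          intro p hp h1 h2
          have := lt_prime (by omega) hp h1
          have := (hp.dvd_factorial).1 h2
          omega
        apply c1.dvd_of_dvd_mul_left
        rw [← Nat.descFactorial_eq_factorial_mul_choose, Nat.descFactorial_eq_prod_range]
        refine Dvd.dvd.trans ?_ (Finset.dvd_prod_of_mem _ (Finset.mem_range.2 (hxu k hk' i)))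
        by_cases hle : x k i ≤ X i
        · exact (Nat.modEq_iff_dvd' hle).1 (hX i k hk).symm
        · rw [Nat.sub_eq_zero_of_le (by omega)]; exact dvd_zero _
    · rw [choose_qq hyB, Nat.modEq_iff_dvd, Nat.cast_prod]
      apply Finset.prod_dvd_of_coprime
      · intro j hj k hk hne
        exact Nat.isCoprime_iff_coprime.2 (cop hj hk hne)
      · intro k hk
        have hk' := Finset.mem_range.1 hk
        rw [← Nat.modEq_iff_dvd]
        have e := sub_modEq (B := B) (k := k) (by omega) dvd_rfl
        have e1 := fc _ _ _ (X) (x k) e.symm (fun i => hX i k hk)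
        have e2 := gc _ _ _ (X) (x k) e.symm (fun i => hX i k hk)
        rw [hx k hk'] at e1
        exact e1.trans e2.symm
  · rintro ⟨B, u, hB, X, h1, h2⟩ k hk
    have hyB : y ≤ B := by omega
    rw [choose_qq hyB] at h1 h2
    obtain ⟨p, hp, hpq⟩ := Nat.exists_prime_and_dvd (n := qq B k) (by
      have := qq_gt (B := B) (k := k) (by omega) (by omega)
      omega)
    have hBp := lt_prime (by omega) hp hpq
    have hpM : p ∣ ∏ k ∈ Finset.range y, qq B k :=
      hpq.trans (Finset.dvd_prod_of_mem _ (Finset.mem_range.2 hk))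
    have hr : ∀ i, ∃ j < u, j ≡ X i [MOD p] := fun i => exists_residue hp (hpM.trans (h1 i))
    choose x hxu hxX using hr
    refine ⟨x, ?_⟩
    have e := sub_modEq (B := B) (k := k) (by omega) hpq
    have e1 := fc _ _ _ _ _ e hxX
    have e2 := gc _ _ _ _ _ e hxX
    have e3 := (e1.trans (h2.of_dvd hpM)).trans e2.symm
    have b1 := fm k y x (fun _ => u) hk.le (fun i => (hxu i).le)
    have b2 := gm k y x (fun _ => u) hk.le (fun i => (hxu i).le)
    exact Nat.ModEq.eq_of_lt_of_lt e3 (by omega) (by omega)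
end DavisAux
namespace DavisAux
section
open Dioph MvPolynomial
theorem poly_split {γ : Type} (p : Poly γ) : ∃ F G : MvPolynomial γ ℕ,
    ∀ v : γ → ℕ, p v = (eval v F : ℤ) - (eval v G : ℤ) := by
  refine Poly.induction (C := fun p => ∃ F G : MvPolynomial γ ℕ,
    ∀ v : γ → ℕ, p v = (eval v F : ℤ) - (eval v G : ℤ)) ?_ ?_ ?_ ?_ p
  · intro i
    exact ⟨X i, 0, fun v => by simp⟩
  · intro n
    refine ⟨C n.toNat, C (-n).toNat, fun v => ?_⟩
    simp only [Poly.const_apply, eval_C]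
    omega
  · rintro f g ⟨F, G, h⟩ ⟨F', G', h'⟩
    refine ⟨F + G', G + F', fun v => ?_⟩
    rw [Poly.sub_apply, h, h']
    simp only [map_add]; push_cast; ring
  · rintro f g ⟨F, G, h⟩ ⟨F', G', h'⟩
    refine ⟨F * F' + G * G', F * G' + G * F', fun v => ?_⟩
    rw [Poly.mul_apply, h, h']
    simp only [map_add, map_mul]; push_cast; ring

theorem dioph_split {α : Type} {S : Set (α → ℕ)} (h : Dioph S) :
    ∃ (m : ℕ) (F G : MvPolynomial (α ⊕ Fin m) ℕ), ∀ v, v ∈ S ↔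
      ∃ x : Fin m → ℕ, eval (Sum.elim v x) F = eval (Sum.elim v x) G := by
  classical
  obtain ⟨β, p, hp⟩ := h
  obtain ⟨F, G, hFG⟩ := poly_split p
  obtain ⟨s, F', G', rfl, rfl⟩ := exists_finset_rename₂ F G
  let t : Finset β := s.toRight
  let e := t.equivFin
  let φ : {x // x ∈ s} → α ⊕ Fin t.card := fun x => match x with
    | ⟨Sum.inl a, _⟩ => Sum.inl a
    | ⟨Sum.inr b, hb⟩ => Sum.inr (e ⟨b, Finset.mem_toRight.2 hb⟩)
  refine ⟨t.card, rename φ F', rename φ G', fun v => ?_⟩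
  rw [hp]
  simp only [hFG, eval_rename, sub_eq_zero, Nat.cast_inj]
  constructor
  · rintro ⟨x, hx⟩
    refine ⟨fun j => x (e.symm j), ?_⟩
    have : (Sum.elim v fun j => x (e.symm j)) ∘ φ = Sum.elim v x ∘ (fun x : {x // x ∈ s} => x.1) := by
      funext ⟨i, hi⟩
      cases i <;> simp [φ]
    rw [this]; exact hx
  · rintro ⟨x, hx⟩
    refine ⟨fun b => if hb : b ∈ t then x (e ⟨b, hb⟩) else 0, ?_⟩
    have : (Sum.elim v fun b => if hb : b ∈ t then x (e ⟨b, hb⟩) else 0) ∘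
        (fun x : {x // x ∈ s} => x.1) = Sum.elim v x ∘ φ := by
      funext ⟨i, hi⟩
      cases i with
      | inl a => simp [φ]
      | inr b =>
        have : b ∈ t := Finset.mem_toRight.2 hi
        simp [φ, this]
    rw [this]; exact hx

theorem eval_mono' {γ : Type} (F : MvPolynomial γ ℕ) {v w : γ → ℕ} (h : ∀ i, v i ≤ w i) :
    eval v F ≤ eval w F := by
  induction F using MvPolynomial.induction_on with
  | C a => simp
  | add p q hp hq => simp only [map_add]; exact add_le_add hp hq
  | mul_X p i hp => simp only [map_mul, eval_X]; exact Nat.mul_le_mul hp (h i)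

theorem eval_modEq {γ : Type} (F : MvPolynomial γ ℕ) (n : ℕ) {v w : γ → ℕ}
    (h : ∀ i, v i ≡ w i [MOD n]) : eval v F ≡ eval w F [MOD n] := by
  induction F using MvPolynomial.induction_on with
  | C a => simp [Nat.ModEq.refl]
  | add p q hp hq => simp only [map_add]; exact hp.add hq
  | mul_X p i hp => simp only [map_mul, eval_X]; exact hp.mul (h i)

theorem eval_dioph {γ δ : Type} (F : MvPolynomial γ ℕ) (φ : (δ → ℕ) → γ → ℕ)
    (h : ∀ i, DiophFn fun w => φ w i) : DiophFn fun w => eval (φ w) F := by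
  induction F using MvPolynomial.induction_on with
  | C a => simp only [eval_C]; exact const_dioph a
  | add p q hp hq => simp only [map_add]; exact add_dioph hp hq
  | mul_X p i hp => simp only [map_mul, eval_X]; exact mul_dioph hp (h i)

theorem ex_dioph' {α : Type} {R : (α → ℕ) → ℕ → Prop}
    (h : Dioph {w : Option α → ℕ | R (fun i => w (some i)) (w none)}) :
    Dioph {v : α → ℕ | ∃ x, R v x} :=
  Dioph.ext (ex1_dioph h) fun _ => Iff.rfl

theorem forall_fin_dioph {α : Type} {m : ℕ} {R : (α → ℕ) → Fin m → Prop}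
    (h : ∀ i, Dioph {v | R v i}) : Dioph {v : α → ℕ | ∀ i, R v i} := by
  refine Dioph.ext (DiophList.forall ((List.finRange m).map fun i => {v | R v i}) ?_) ?_
  · rw [List.forall_iff_forall_mem]
    intro S hS
    obtain ⟨i, _, rfl⟩ := List.mem_map.1 hS
    exact h i
  · intro v
    simp [List.forall_iff_forall_mem]

theorem forall_lt_dioph {α : Type} {R : (α → ℕ) → ℕ → Prop} {g : (α → ℕ) → ℕ} (dg : DiophFn g)
    (h : Dioph {w : Option α → ℕ | R (fun i => w (some i)) (w none)}) :
    Dioph {v : α → ℕ | ∀ k < g v, R v k} := by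
  obtain ⟨m, F, G, hFG⟩ := dioph_split h
  have hR : ∀ v k, R v k ↔ ∃ x : Fin m → ℕ, eval (Sum.elim (Option.elim' k v) x) F =
      eval (Sum.elim (Option.elim' k v) x) G := fun v k => hFG (Option.elim' k v)
  have mono : ∀ (v : α → ℕ) (F : MvPolynomial (Option α ⊕ Fin m) ℕ) (k k' : ℕ) (x x' : Fin m → ℕ),
      k ≤ k' → x ≤ x' → eval (Sum.elim (Option.elim' k v) x) F ≤
        eval (Sum.elim (Option.elim' k' v) x') F := by
    intro v F k k' x x' hk hx
    apply eval_mono'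
    rintro ((_ | i) | i)
    · exact hk
    · exact le_rfl
    · exact hx i
  have cong : ∀ (v : α → ℕ) (F : MvPolynomial (Option α ⊕ Fin m) ℕ) (n k k' : ℕ)
      (x x' : Fin m → ℕ), k ≡ k' [MOD n] → (∀ i, x i ≡ x' i [MOD n]) →
      eval (Sum.elim (Option.elim' k v) x) F ≡
        eval (Sum.elim (Option.elim' k' v) x') F [MOD n] := by
    intro v F n k k' x x' hk hx
    apply eval_modEq
    rintro ((_ | i) | i)
    · exact hk
    · exact Nat.ModEq.refl _
    · exact hx i
  have dio : ∀ {δ : Type} (F : MvPolynomial (Option α ⊕ Fin m) ℕ) (v : (δ → ℕ) → α → ℕ)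
      (k : (δ → ℕ) → ℕ) (x : (δ → ℕ) → Fin m → ℕ), (∀ i, DiophFn fun w => v w i) →
      DiophFn k → (∀ i, DiophFn fun w => x w i) →
      DiophFn fun w => eval (Sum.elim (Option.elim' (k w) (v w)) (x w)) F := by
    intro δ F v k x hv hk hx
    apply eval_dioph
    rintro ((_ | i) | i)
    · exact hk
    · exact hv i
    · exact hx i
  have main : Dioph {v : α → ℕ | ∃ B u, (g v + u +
      eval (Sum.elim (Option.elim' (g v) v) (fun _ => u)) F +
      eval (Sum.elim (Option.elim' (g v) v) (fun _ => u)) G + 3 = B) ∧ ∃ X : Fin m → ℕ,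
        (∀ i, (B.factorial ^ 2 - 1).choose (g v) ∣ (X i).choose u) ∧
        eval (Sum.elim (Option.elim' (B.factorial ^ 2 - 1) v) X) F ≡
          eval (Sum.elim (Option.elim' (B.factorial ^ 2 - 1) v) X) G
          [MOD (B.factorial ^ 2 - 1).choose (g v)]} := by
    apply ex_dioph'
    apply ex_dioph'
    apply Dioph.inter
    · have du : DiophFn fun w : Option (Option α) → ℕ => w none := proj_dioph _
      have dB : DiophFn fun w : Option (Option α) → ℕ => w (some none) := proj_dioph _
      have dg' : DiophFn fun w : Option (Option α) → ℕ => g (fun i => w (some (some i))) :=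
        reindex_diophFn (fun i => some (some i)) dg
      have dv : ∀ i, DiophFn fun w : Option (Option α) → ℕ => w (some (some i)) :=
        fun i => proj_dioph _
      exact eq_dioph (add_dioph (add_dioph (add_dioph (add_dioph dg' du)
        (dio F _ _ _ dv dg' (fun _ => du))) (dio G _ _ _ dv dg' (fun _ => du)))
        (const_dioph 3)) dB
    · have key : Dioph {w : Option (Option α) ⊕ Fin m → ℕ |
          (∀ i, ((w (.inl (some none))).factorial ^ 2 - 1).choose
            (g (fun i => w (.inl (some (some i))))) ∣ (w (.inr i)).choose (w (.inl none))) ∧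
          eval (Sum.elim (Option.elim' ((w (.inl (some none))).factorial ^ 2 - 1)
            (fun i => w (.inl (some (some i))))) (fun i => w (.inr i))) F ≡
          eval (Sum.elim (Option.elim' ((w (.inl (some none))).factorial ^ 2 - 1)
            (fun i => w (.inl (some (some i))))) (fun i => w (.inr i))) G
          [MOD ((w (.inl (some none))).factorial ^ 2 - 1).choose
            (g (fun i => w (.inl (some (some i)))))]} := by
        have du : DiophFn fun w : Option (Option α) ⊕ Fin m → ℕ => w (.inl none) := proj_dioph _
        have dB : DiophFn fun w : Option (Option α) ⊕ Fin m → ℕ => w (.inl (some none)) :=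
          proj_dioph _
        have dg' : DiophFn fun w : Option (Option α) ⊕ Fin m → ℕ =>
            g (fun i => w (.inl (some (some i)))) :=
          reindex_diophFn (fun i => Sum.inl (some (some i))) dg
        have dv : ∀ i, DiophFn fun w : Option (Option α) ⊕ Fin m → ℕ =>
            w (.inl (some (some i))) := fun i => proj_dioph _
        have dX : ∀ i, DiophFn fun w : Option (Option α) ⊕ Fin m → ℕ =>
            w (.inr i) := fun i => proj_dioph _
        have dT := sub_dioph (pow_dioph (factorial_dioph dB) (const_dioph 2)) (const_dioph 1)
        have dM := choose_dioph dT dg'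
        apply Dioph.inter
        · exact forall_fin_dioph fun i => dvd_dioph dM (choose_dioph (dX i) du)
        · exact modEq_dioph (dio F _ _ _ dv dT dX) (dio G _ _ _ dv dT dX) dM
      exact Dioph.ext (ex_dioph key) fun _ => Iff.rfl
  refine Dioph.ext main fun v => ?_
  have := bounded_core (fun k x => eval (Sum.elim (Option.elim' k v) x) F)
    (fun k x => eval (Sum.elim (Option.elim' k v) x) G) (mono v F) (mono v G)
    (cong v F) (cong v G) (g v)
  simp only [Set.mem_ofPred_eq, hR]
  exact this.symm
end
end DavisAux
namespace DavisAux
section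
open Dioph

theorem lift_dioph {α : Type} {f : (α → ℕ) → ℕ} (df : DiophFn f) :
    DiophFn fun w : Option α → ℕ => f (fun i => w (some i)) := reindex_diophFn some df

theorem pair_dioph {α : Type} {f g : (α → ℕ) → ℕ} (df : DiophFn f) (dg : DiophFn g) :
    DiophFn fun v => Nat.pair (f v) (g v) := by
  have df' := lift_dioph df
  have dg' := lift_dioph dg
  have dn : DiophFn fun w : Option α → ℕ => w none := proj_dioph _
  have h1 := Dioph.inter (lt_dioph df' dg') (eq_dioph (add_dioph (mul_dioph dg' dg') df') dn)
  have h2 := Dioph.inter (le_dioph dg' df')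
    (eq_dioph (add_dioph (add_dioph (mul_dioph df' df') df') dg') dn)
  refine Dioph.ext (Dioph.union h1 h2) fun w => ?_
  let a : ℕ := f fun i => w (some i)
  let b : ℕ := g fun i => w (some i)
  change (a < b ∧ b * b + a = w none) ∨ (b ≤ a ∧ a * a + a + b = w none) ↔ Nat.pair a b = w none
  unfold Nat.pair
  split_ifs with h
  · simp [h]
  · simp [h, not_lt.1 h]

theorem unpair1_dioph {α : Type} {f : (α → ℕ) → ℕ} (df : DiophFn f) :
    DiophFn fun v => (f v).unpair.1 := by
  have h : Dioph {w : Option α → ℕ | ∃ b, Nat.pair (w none) b = f (fun i => w (some i))} := by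
    apply ex_dioph'
    exact eq_dioph (pair_dioph (proj_dioph _) (proj_dioph _)) (lift_dioph (lift_dioph df))
  refine Dioph.ext h fun w => ?_
  change (∃ b, Nat.pair (w none) b = f (fun i => w (some i))) ↔
    (f (fun i => w (some i))).unpair.1 = w none
  constructor
  · rintro ⟨b, hb⟩; rw [← hb, Nat.unpair_pair]
  · intro h; exact ⟨(f (fun i => w (some i))).unpair.2, by rw [← h, Nat.pair_unpair]⟩

theorem unpair2_dioph {α : Type} {f : (α → ℕ) → ℕ} (df : DiophFn f) :
    DiophFn fun v => (f v).unpair.2 := by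
  have h : Dioph {w : Option α → ℕ | ∃ b, Nat.pair b (w none) = f (fun i => w (some i))} := by
    apply ex_dioph'
    exact eq_dioph (pair_dioph (proj_dioph _) (proj_dioph _)) (lift_dioph (lift_dioph df))
  refine Dioph.ext h fun w => ?_
  change (∃ b, Nat.pair b (w none) = f (fun i => w (some i))) ↔
    (f (fun i => w (some i))).unpair.2 = w none
  constructor
  · rintro ⟨b, hb⟩; rw [← hb, Nat.unpair_pair]
  · intro h; exact ⟨(f (fun i => w (some i))).unpair.1, by rw [← h, Nat.pair_unpair]⟩

theorem beta_dioph {α : Type} {f g : (α → ℕ) → ℕ} (df : DiophFn f) (dg : DiophFn g) :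
    DiophFn fun v => Nat.beta (f v) (g v) :=
  mod_dioph (unpair1_dioph df) (add_dioph (mul_dioph (add_dioph dg (const_dioph 1))
    (unpair2_dioph df)) (const_dioph 1))

theorem exists_beta (z : ℕ → ℕ) (n : ℕ) : ∃ s, ∀ i ≤ n, Nat.beta s i = z i := by
  refine ⟨Nat.unbeta ((List.range (n + 1)).map z), fun i hi => ?_⟩
  have := Nat.beta_unbeta_coe ((List.range (n + 1)).map z) ⟨i, by simp; omega⟩
  simpa using this

theorem mem_prec (f : Part ℕ) (g : ℕ → ℕ → Part ℕ) (n : ℕ) (y : ℕ) :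
    y ∈ (Nat.rec f (fun k IH => IH.bind fun i => g k i) n : Part ℕ) ↔
      ∃ s, Nat.beta s 0 ∈ f ∧ (∀ i < n, Nat.beta s (i + 1) ∈ g i (Nat.beta s i)) ∧
        Nat.beta s n = y := by
  constructor
  · intro h
    have : ∃ z : ℕ → ℕ, z 0 ∈ f ∧ (∀ i < n, z (i + 1) ∈ g i (z i)) ∧ z n = y := by
      induction n generalizing y with
      | zero => exact ⟨fun _ => y, h, by simp, rfl⟩
      | succ n ih =>
        obtain ⟨i, hi, hy⟩ := Part.mem_bind_iff.1 h
        obtain ⟨z, h0, h1, h2⟩ := ih i hi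
        refine ⟨fun k => if k ≤ n then z k else y, by simpa using h0, ?_, by simp⟩
        intro k hk
        by_cases hkn : k < n
        · have e1 : k + 1 ≤ n := hkn
          have e2 : k ≤ n := hkn.le
          simp only [e1, e2, if_true]
          exact h1 k hkn
        · have : k = n := by omega
          subst this
          simpa [h2] using hy
    obtain ⟨z, h0, h1, h2⟩ := this
    obtain ⟨s, hs⟩ := exists_beta z n
    refine ⟨s, by rwa [hs 0 (by omega)], fun i hi => ?_, by rwa [hs n le_rfl]⟩
    rw [hs _ hi, hs i hi.le]
    exact h1 i hi
  · rintro ⟨s, h0, h1, rfl⟩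
    induction n with
    | zero => exact h0
    | succ n ih =>
      exact Part.mem_bind_iff.2 ⟨_, ih (fun i hi => h1 i (by omega)), h1 n (by omega)⟩

/-- Partial functions with a Diophantine graph, in a form closed under substitution. -/
def GraphD (f : ℕ →. ℕ) : Prop :=
  ∀ {α : Type} (g h : (α → ℕ) → ℕ), DiophFn g → DiophFn h → Dioph {v | h v ∈ f (g v)}

theorem partrec_graphD {f : ℕ →. ℕ} (hf : Nat.Partrec f) : GraphD f := by
  induction hf with
  | zero =>
    intro α g h dg dh
    refine Dioph.ext (eq_dioph dh (const_dioph 0)) fun v => ?_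
    change h v = 0 ↔ h v ∈ (Part.some 0 : Part ℕ)
    simp
  | succ =>
    intro α g h dg dh
    refine Dioph.ext (eq_dioph dh (add_dioph dg (const_dioph 1))) fun v => ?_
    change h v = g v + 1 ↔ h v ∈ (Part.some (Nat.succ (g v)) : Part ℕ)
    simp
  | left =>
    intro α g h dg dh
    refine Dioph.ext (eq_dioph dh (unpair1_dioph dg)) fun v => ?_
    change h v = _ ↔ h v ∈ (Part.some _ : Part ℕ)
    simp
  | right =>
    intro α g h dg dh
    refine Dioph.ext (eq_dioph dh (unpair2_dioph dg)) fun v => ?_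
    change h v = _ ↔ h v ∈ (Part.some _ : Part ℕ)
    simp
  | @pair f1 f2 _ _ i1 i2 =>
    intro α g h dg dh
    refine Dioph.ext (Dioph.inter (i1 g _ dg (unpair1_dioph dh)) (i2 g _ dg (unpair2_dioph dh)))
      fun v => ?_
    change ((h v).unpair.1 ∈ f1 (g v) ∧ (h v).unpair.2 ∈ f2 (g v)) ↔
      h v ∈ (Nat.pair <$> f1 (g v) <*> f2 (g v))
    simp only [Seq.seq, Part.map_eq_map, Part.mem_bind_iff, Part.mem_map_iff]
    constructor
    · rintro ⟨h1, h2⟩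
      exact ⟨_, ⟨_, h1, rfl⟩, _, h2, Nat.pair_unpair _⟩
    · rintro ⟨_, ⟨a, ha, rfl⟩, b, hb, e⟩
      rw [← e, Nat.unpair_pair]
      exact ⟨ha, hb⟩
  | @comp f1 f2 _ _ i1 i2 =>
    intro α g h dg dh
    have : Dioph {v : α → ℕ | ∃ z, z ∈ f2 (g v) ∧ h v ∈ f1 z} := by
      apply ex_dioph'
      exact Dioph.inter (i2 _ _ (lift_dioph dg) (proj_dioph _))
        (i1 _ _ (proj_dioph _) (lift_dioph dh))
    refine Dioph.ext this fun v => ?_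
    exact Part.mem_bind_iff.symm
  | @prec f1 f2 _ _ i1 i2 =>
    intro α g h dg dh
    have : Dioph {v : α → ℕ | ∃ s, Nat.beta s 0 ∈ f1 (g v).unpair.1 ∧
        (∀ i < (g v).unpair.2, Nat.beta s (i + 1) ∈
          f2 (Nat.pair (g v).unpair.1 (Nat.pair i (Nat.beta s i)))) ∧
        Nat.beta s (g v).unpair.2 = h v} := by
      apply ex_dioph'
      have dg' := lift_dioph dg
      have ds : DiophFn fun w : Option α → ℕ => w none := proj_dioph _
      apply Dioph.inter
      · exact i1 _ _ (unpair1_dioph dg') (beta_dioph ds (const_dioph 0))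
      apply Dioph.inter
      · apply forall_lt_dioph (R := fun w i => Nat.beta (w none) (i + 1) ∈
          f2 (Nat.pair (g fun j => w (some j)).unpair.1 (Nat.pair i (Nat.beta (w none) i))))
          (unpair2_dioph dg')
        have ds' := lift_dioph ds
        have di : DiophFn fun w : Option (Option α) → ℕ => w none := proj_dioph _
        exact i2 _ _ (pair_dioph (unpair1_dioph (lift_dioph dg'))
          (pair_dioph di (beta_dioph ds' di))) (beta_dioph ds' (add_dioph di (const_dioph 1)))
      · exact eq_dioph (beta_dioph ds (unpair2_dioph dg')) (lift_dioph dh)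
    refine Dioph.ext this fun v => ?_
    exact (mem_prec _ (fun k i => f2 (Nat.pair (g v).unpair.1 (Nat.pair k i))) _ _).symm
  | @rfind f1 _ i1 =>
    intro α g h dg dh
    have : Dioph {v : α → ℕ | 0 ∈ f1 (Nat.pair (g v) (h v)) ∧
        ∀ k < h v, ∃ z, z ≠ 0 ∧ z ∈ f1 (Nat.pair (g v) k)} := by
      apply Dioph.inter
      · exact i1 _ _ (pair_dioph dg dh) (const_dioph 0)
      · apply forall_lt_dioph (R := fun v k => ∃ z, z ≠ 0 ∧ z ∈ f1 (Nat.pair (g v) k)) dh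
        apply ex_dioph'
        exact Dioph.inter (ne_dioph (proj_dioph _) (const_dioph 0))
          (i1 _ _ (pair_dioph (lift_dioph (lift_dioph dg)) (proj_dioph (some none)))
            (proj_dioph _))
    refine Dioph.ext this fun v => ?_
    change (0 ∈ f1 (Nat.pair (g v) (h v)) ∧
        ∀ k < h v, ∃ z, z ≠ 0 ∧ z ∈ f1 (Nat.pair (g v) k)) ↔
        h v ∈ Nat.rfind fun n => (fun m => decide (m = 0)) <$> f1 (Nat.pair (g v) n)
    refine Iff.trans ?_ Nat.mem_rfind.symm
    have e1 : ∀ P : Part ℕ, true ∈ (P.map fun m => decide (m = 0)) ↔ 0 ∈ P := by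
      intro P; simp
    have e2 : ∀ P : Part ℕ, false ∈ (P.map fun m => decide (m = 0)) ↔ ∃ z, z ≠ 0 ∧ z ∈ P := by
      intro P; simp [and_comm]
    exact and_congr (e1 _).symm (forall_congr' fun k => forall_congr' fun _ => (e2 _).symm)
end
end DavisAux
namespace DavisAux
section
open Dioph MvPolynomial

theorem exists_poly : ∃ (m : ℕ) (F : MvPolynomial (Fin (m + 1)) ℤ),
    ¬ ComputablePred (fun a : ℕ => ∃ x : Fin m → ℕ,
      eval (Fin.cons (a : ℤ) (fun i => ((x i : ℕ) : ℤ))) F = 0) := by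
  have hf : Nat.Partrec fun n => Nat.Partrec.Code.eval (Denumerable.ofNat Nat.Partrec.Code n) 0 :=
    Partrec.nat_iff.1 (Nat.Partrec.Code.eval_part.comp
      (Computable.ofNat Nat.Partrec.Code) (Computable.const 0))
  have hd : Dioph {v : Unit → ℕ | ∃ y, y ∈
      Nat.Partrec.Code.eval (Denumerable.ofNat Nat.Partrec.Code (v ())) 0} := by
    apply ex_dioph'
    exact partrec_graphD hf _ _ (proj_dioph _) (proj_dioph _)
  obtain ⟨m, F, G, h⟩ := dioph_split hd
  let φ : Unit ⊕ Fin m → Fin (m + 1) := Sum.elim (fun _ => 0) Fin.succ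
  refine ⟨m, rename φ (map (Nat.castRingHom ℤ) F) - rename φ (map (Nat.castRingHom ℤ) G), ?_⟩
  intro hc
  apply ComputablePred.halting_problem 0
  have h2 : ∀ c : Nat.Partrec.Code, (∃ x : Fin m → ℕ,
      eval (Fin.cons ((Encodable.encode c : ℕ) : ℤ) (fun i => ((x i : ℕ) : ℤ)))
        (rename φ (map (Nat.castRingHom ℤ) F) - rename φ (map (Nat.castRingHom ℤ) G)) = 0) ↔
      (c.eval 0).Dom := by
    intro c
    have h3 := h (fun _ => Encodable.encode c)
    have h4 : (fun _ : Unit => Encodable.encode c) ∈ {v : Unit → ℕ | ∃ y, y ∈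
      Nat.Partrec.Code.eval (Denumerable.ofNat Nat.Partrec.Code (v ())) 0} ↔ (c.eval 0).Dom := by
      rw [Part.dom_iff_mem, Set.mem_ofPred_eq, Denumerable.ofNat_encode]
    rw [← h4, h3]
    apply exists_congr
    intro x
    have e : (Fin.cons ((Encodable.encode c : ℕ) : ℤ) (fun i => ((x i : ℕ) : ℤ)) : Fin (m + 1) → ℤ) ∘ φ
      = fun i => ((Sum.elim (fun _ => Encodable.encode c) x i : ℕ) : ℤ) := by
      funext i
      rcases i with i | i <;> simp [φ]
    have e2 : ∀ P : MvPolynomial (Unit ⊕ Fin m) ℕ,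
        eval (Fin.cons ((Encodable.encode c : ℕ) : ℤ) (fun i => ((x i : ℕ) : ℤ)))
          (rename φ (map (Nat.castRingHom ℤ) P)) =
          ((eval (Sum.elim (fun _ => Encodable.encode c) x) P : ℕ) : ℤ) := by
      intro P
      rw [eval_rename, e, eval_map]
      exact (eval₂_comp_left (Nat.castRingHom ℤ) (RingHom.id ℕ) _ P).symm
    rw [map_sub, e2, e2, sub_eq_zero, Nat.cast_inj]
  obtain ⟨hdec, hcomp⟩ := hc
  exact ComputablePred.of_eq ⟨fun c => hdec _, hcomp.comp Computable.encode⟩ h2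


theorem count_poly {m : ℕ} (F : MvPolynomial (Fin (m + 1)) ℤ) (N : ℕ) :
    ∃ P : MvPolynomial (Fin (m + 1 + 1)) ℤ, ∀ a : ℕ,
      ((∃ x : Fin m → ℕ, eval (Fin.cons (a : ℤ) (fun i => ((x i : ℕ) : ℤ))) F = 0) →
        Set.encard {x : Fin (m + 1) → ℕ |
          eval (Fin.cons (a : ℤ) (fun i => ((x i : ℕ) : ℤ))) P = 0} = ⊤) ∧
      ((¬ ∃ x : Fin m → ℕ, eval (Fin.cons (a : ℤ) (fun i => ((x i : ℕ) : ℤ))) F = 0) →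
        Set.encard {x : Fin (m + 1) → ℕ |
          eval (Fin.cons (a : ℤ) (fun i => ((x i : ℕ) : ℤ))) P = 0} = N) := by
  let ψ : Fin (m + 1) → Fin (m + 1 + 1) := Fin.cons 0 (fun i => i.succ.succ)
  let P : MvPolynomial (Fin (m + 1 + 1)) ℤ := rename ψ F *
    ((∏ j ∈ Finset.range N, (X 1 - C (j : ℤ))) ^ 2 + ∑ i : Fin m, (X i.succ.succ) ^ 2)
  have hP : ∀ (a : ℕ) (x : Fin (m + 1) → ℕ),
      eval (Fin.cons (a : ℤ) (fun i => ((x i : ℕ) : ℤ))) P = 0 ↔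
        eval (Fin.cons (a : ℤ) (fun i => ((x i.succ : ℕ) : ℤ))) F = 0 ∨
        (x 0 < N ∧ ∀ i : Fin m, x i.succ = 0) := by
    intro a x
    have e : (Fin.cons (a : ℤ) (fun i => ((x i : ℕ) : ℤ)) : Fin (m + 1 + 1) → ℤ) ∘ ψ =
        Fin.cons (a : ℤ) (fun i => ((x i.succ : ℕ) : ℤ)) := by
      funext i
      refine Fin.cases ?_ (fun i => ?_) i <;> simp [ψ]
    have e1 : (Fin.cons (a : ℤ) (fun i => ((x i : ℕ) : ℤ)) : Fin (m + 1 + 1) → ℤ) 1 = x 0 := rfl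
    simp only [P, map_mul, eval_rename, e, mul_eq_zero, map_add, map_pow, map_prod, map_sub,
      eval_X, eval_C, map_sum, e1, Fin.cons_succ]
    apply or_congr Iff.rfl
    have h1 : 0 ≤ (∏ j ∈ Finset.range N, ((x 0 : ℤ) - j)) ^ 2 := sq_nonneg _
    have h2 : ∀ i ∈ (Finset.univ : Finset (Fin m)), 0 ≤ ((x i.succ : ℕ) : ℤ) ^ 2 :=
      fun i _ => sq_nonneg _
    rw [add_eq_zero_iff_of_nonneg h1 (Finset.sum_nonneg h2), Finset.sum_eq_zero_iff_of_nonneg h2,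
      sq_eq_zero_iff, Finset.prod_eq_zero_iff]
    apply and_congr
    · constructor
      · rintro ⟨j, hj, hh⟩
        have := Finset.mem_range.1 hj
        omega
      · intro hh
        exact ⟨x 0, Finset.mem_range.2 hh, sub_self _⟩
    · simp
  refine ⟨P, fun a => ⟨?_, ?_⟩⟩
  · rintro ⟨x, hx⟩
    rw [Set.encard_eq_top_iff]
    refine Set.Infinite.mono (s := Set.range fun z : ℕ => (Fin.cons z x : Fin (m + 1) → ℕ)) ?_
      (Set.infinite_range_of_injective fun z z' h => ?_)
    · rintro _ ⟨z, rfl⟩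
      exact (hP a _).2 (Or.inl (by simpa using hx))
    · simpa using congrFun h 0
  · intro hno
    have : {x : Fin (m + 1) → ℕ | eval (Fin.cons (a : ℤ) (fun i => ((x i : ℕ) : ℤ))) P = 0} =
        (fun z : ℕ => (Fin.cons z (fun _ => 0) : Fin (m + 1) → ℕ)) '' Set.Iio N := by
      ext x
      rw [Set.mem_ofPred_eq, hP]
      constructor
      · rintro (h | ⟨h1, h2⟩)
        · exact absurd ⟨_, h⟩ hno
        · refine ⟨x 0, h1, ?_⟩
          funext i
          refine Fin.cases ?_ (fun i => ?_) i
          · simp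
          · simp [h2]
      · rintro ⟨z, hz, rfl⟩
        exact Or.inr ⟨hz, fun i => by simp⟩
    rw [this, Function.Injective.encard_image (fun z z' h => by simpa using congrFun h 0)]
    rw [← Finset.coe_Iio, Set.encard_coe_eq_coe_finsetCard]
    simp
end
end DavisAux

/-- Davis (1972): for every proper nonempty subset `A` of ℕ∞ = ℕ ∪ {∞},
there is a parametric family of Diophantine equations for which no algorithm
decides whether the number of distinct solutions in ℕ belongs to `A`. -/
theorem davis_number_of_solutions (A : Set ℕ∞) (hne : A ≠ ∅) (hproper : A ≠ Set.univ) :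
    ∃ (n : ℕ) (p : MvPolynomial (Fin (n + 1)) ℤ),
      ¬ ComputablePred (fun a : ℕ =>
        Set.encard {x : Fin n → ℕ |
          MvPolynomial.eval (Fin.cons (a : ℤ) (fun i => ((x i : ℕ) : ℤ))) p = 0} ∈ A) := by
  obtain ⟨m, F, hF⟩ := DavisAux.exists_poly
  by_cases htop : (⊤ : ℕ∞) ∈ A
  · obtain ⟨N, hN⟩ := (Set.ne_univ_iff_exists_notMem A).1 hproper
    have hNt : N ≠ ⊤ := fun h => hN (h ▸ htop)
    lift N to ℕ using hNt
    obtain ⟨P, hP⟩ := DavisAux.count_poly F N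
    refine ⟨m + 1, P, fun hc => hF (hc.of_eq fun a => ?_)⟩
    obtain ⟨h1, h2⟩ := hP a
    by_cases h : ∃ x : Fin m → ℕ,
      MvPolynomial.eval (Fin.cons (a : ℤ) (fun i => ((x i : ℕ) : ℤ))) F = 0
    · rw [h1 h]; exact iff_of_true htop h
    · rw [h2 h]; exact iff_of_false hN h
  · obtain ⟨N, hN⟩ := Set.nonempty_iff_ne_empty.2 hne
    have hNt : N ≠ ⊤ := fun h => htop (h ▸ hN)
    lift N to ℕ using hNt
    obtain ⟨P, hP⟩ := DavisAux.count_poly F N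
    refine ⟨m + 1, P, fun hc => hF (hc.not.of_eq fun a => ?_)⟩
    obtain ⟨h1, h2⟩ := hP a
    by_cases h : ∃ x : Fin m → ℕ,
      MvPolynomial.eval (Fin.cons (a : ℤ) (fun i => ((x i : ℕ) : ℤ))) F = 0
    · rw [h1 h]; exact iff_of_true htop h
    · rw [h2 h]; exact iff_of_false (not_not.2 hN) h
end

section
/- Reduction of integer solvability to natural-number solvability via Lagrange's four-square theorem: for every n ∈ ℕ and every polynomial p ∈ MvPolynomial (Fin n) ℤ, the equation p = 0 has a solution with all variables in ℕ (coerced into ℤ) if and only if the equation obtained by substituting for each variable a sum of four squares has a solution in ℤ; that is, (∃ x : Fin n → ℕ, p((↑) ∘ x) = 0) ↔ (∃ y : Fin n → Fin 4 → ℤ, p(fun i => ∑ j, (y i j)^2) = 0). -/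
/-- Via Lagrange's four-square theorem: a polynomial equation over ℤ has a
solution in natural numbers iff the equation obtained by substituting a sum of
four squares for each variable has a solution in integers. -/
theorem nat_solvable_iff_four_squares_int_solvable (n : ℕ)
    (p : MvPolynomial (Fin n) ℤ) :
    (∃ x : Fin n → ℕ, MvPolynomial.eval (fun i => ((x i : ℕ) : ℤ)) p = 0) ↔
    (∃ y : Fin n → Fin 4 → ℤ,
      MvPolynomial.eval (fun i => ∑ j : Fin 4, (y i j) ^ 2) p = 0) := by
  constructor
  · rintro ⟨x, hx⟩
    choose a b c d h using fun i => Nat.sum_four_squares (x i)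
    refine ⟨fun i => ![(a i : ℤ), b i, c i, d i], ?_⟩
    rw [← hx]
    congr 2
    funext i
    rw [← h i]
    simp [Fin.sum_univ_four]
  · rintro ⟨y, hy⟩
    refine ⟨fun i => (∑ j : Fin 4, (y i j) ^ 2).toNat, ?_⟩
    rw [← hy]
    congr 2
    funext i
    exact Int.toNat_of_nonneg (Finset.sum_nonneg fun j _ => sq_nonneg _)
end
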